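/- Let κ ≥ 0 and let b ∈ C^∞(ℝ²) satisfy |∂_y^β b(y)| ≤ C_β ⟨y⟩^{−κ−|β|} for all multi-indices β. Then for every s ∈ ℝ there is a constant C such that ‖[⟨hD⟩^{−1}, b]u‖_{H^{s+2}_{scl}} ≤ C h ‖⟨y⟩^{−κ−1} u‖_{H^s_{scl}} for all u ∈ C_0^∞(ℝ²) and all small h > 0. -/

import Mathlib

open MeasureTheory FourierTransform

/-- The plane `ℝ²`. -/
abbrev Plane := EuclideanSpace ℝ (Fin 2)

/-- The Japanese bracket `⟨y⟩ = (1+|y|²)^{1/2}`, raised to the power `t`: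
`⟨y⟩^t = (1+|y|²)^{t/2}`. -/
noncomputable def jbr (y : Plane) (t : ℝ) : ℝ := (1 + ‖y‖ ^ 2) ^ (t / 2)

/-- The semiclassical operator `⟨hD⟩^s`, the Fourier multiplier with symbol
`⟨hξ⟩^s = (1+h²|ξ|²)^{s/2}`. -/
noncomputable def sclBracket (h s : ℝ) (u : Plane → ℂ) : Plane → ℂ :=
  𝓕⁻ (fun ξ : Plane => (((1 + h ^ 2 * ‖ξ‖ ^ 2) ^ (s / 2) : ℝ)) • 𝓕 u ξ)

/-- The semiclassical Sobolev norm `‖u‖_{H^s_{scl}} = ‖⟨hD⟩^s u‖_{L²(ℝ²)}`. -/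
noncomputable def sclNorm (h s : ℝ) (u : Plane → ℂ) : ENNReal :=
  eLpNorm (sclBracket h s u) 2 volume

/-- The commutator `[⟨hD⟩⁻¹, b]u = ⟨hD⟩⁻¹(bu) - b ⟨hD⟩⁻¹u`. -/
noncomputable def sclCommutator (h : ℝ) (b : Plane → ℝ) (u : Plane → ℂ) :
    Plane → ℂ :=
  fun y => sclBracket h (-1) (fun y' => (b y' : ℂ) * u y') y
    - (b y : ℂ) * sclBracket h (-1) u y

namespace Scl

open scoped ContDiff SchwartzMap ENNReal

lemma jbr_pos (y : Plane) (t : ℝ) : 0 < jbr y t := by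
  unfold jbr; positivity

lemma jbr_mul (y : Plane) (a b : ℝ) : jbr y a * jbr y b = jbr y (a + b) := by
  unfold jbr
  rw [← Real.rpow_add (by positivity)]
  ring_nf

lemma jbr_zero (y : Plane) : jbr y 0 = 1 := by simp [jbr]

lemma jbr_mono (y : Plane) {a b : ℝ} (h : a ≤ b) : jbr y a ≤ jbr y b := by
  unfold jbr
  exact Real.rpow_le_rpow_of_exponent_le (by nlinarith [sq_nonneg ‖y‖]) (by linarith)

lemma jbr_two (y : Plane) : jbr y 2 = 1 + ‖y‖ ^ 2 := by simp [jbr]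

lemma jbr_two_mul (y : Plane) (n : ℕ) : jbr y (2 * n) = (1 + ‖y‖ ^ 2) ^ n := by
  unfold jbr
  rw [mul_div_cancel_left₀ _ (two_ne_zero), Real.rpow_natCast]

lemma jbr_neg (y : Plane) (t : ℝ) : jbr y (-t) = (jbr y t)⁻¹ := by
  apply eq_inv_of_mul_eq_one_left
  rw [jbr_mul]; simp [jbr_zero]

lemma norm_le_jbr (y : Plane) : ‖y‖ ≤ jbr y 1 := by
  unfold jbr
  rw [← Real.sqrt_eq_rpow]
  exact Real.le_sqrt_of_sq_le (by linarith)

lemma jbr_le_of_norm_le {x y : Plane} (h : ‖x‖ ≤ ‖y‖) {t : ℝ} (ht : 0 ≤ t) :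
    jbr x t ≤ jbr y t := by
  unfold jbr
  gcongr

/-- Peetre's inequality. -/
lemma jbr_peetre (x y : Plane) (t : ℝ) :
    jbr x t ≤ 2 ^ (|t| / 2) * jbr y t * jbr (x - y) |t| := by
  have key : ∀ u v : Plane, ∀ r : ℝ, 0 ≤ r →
      jbr (u + v) r ≤ 2 ^ (r / 2) * jbr u r * jbr v r := by
    intro u v r hr
    unfold jbr
    rw [← Real.mul_rpow (by positivity) (by positivity),
      ← Real.mul_rpow (by positivity) (by positivity)]
    apply Real.rpow_le_rpow (by positivity) _ (by positivity)
    nlinarith [norm_add_le u v, norm_nonneg (u + v), norm_nonneg u, norm_nonneg v,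
      sq_nonneg (‖u‖ - ‖v‖), mul_nonneg (sq_nonneg ‖u‖) (sq_nonneg ‖v‖)]
  rcases le_total 0 t with ht | ht
  · rw [abs_of_nonneg ht]
    simpa using key y (x - y) t ht
  · rw [abs_of_nonpos ht]
    have h1 := key x (y - x) (-t) (by linarith)
    rw [add_sub_cancel] at h1
    have e : jbr (y - x) (-t) = jbr (x - y) (-t) := by
      unfold jbr; rw [norm_sub_rev]
    rw [e, jbr_neg x, jbr_neg y] at h1
    have hx := jbr_pos x t
    have hy := jbr_pos y t
    calc jbr x t = jbr x t * jbr y t * (jbr y t)⁻¹ := by field_simp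
      _ ≤ jbr x t * jbr y t * (2 ^ (-t / 2) * (jbr x t)⁻¹ * jbr (x - y) (-t)) := by gcongr
      _ = _ := by field_simp

lemma jbr_temperate (t : ℝ) : (fun y => jbr y t).HasTemperateGrowth :=
  Function.hasTemperateGrowth_one_add_norm_sq_rpow Plane (t / 2)

lemma jbr_contDiff (t : ℝ) : ContDiff ℝ ∞ (fun y => jbr y t) := (jbr_temperate t).1

lemma jbr_hasFDerivAt (t : ℝ) (x : Plane) :
    HasFDerivAt (fun y => jbr y t) ((t * jbr x (t - 2)) • innerSL ℝ x) x := by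
  have h1 : HasFDerivAt (fun y : Plane => 1 + ‖y‖ ^ 2) (2 • innerSL ℝ x) x :=
    ((hasStrictFDerivAt_norm_sq x).hasFDerivAt).const_add 1
  have h2 := h1.rpow_const (p := t / 2) (Or.inl (by positivity))
  have e : (t * jbr x (t - 2)) • innerSL ℝ x
      = (t / 2 * (1 + ‖x‖ ^ 2) ^ (t / 2 - 1)) • 2 • innerSL ℝ x := by
    rw [jbr, show (t - 2) / 2 = t / 2 - 1 by ring]
    module
  rw [e]
  exact h2

lemma jbr_fderiv (t : ℝ) :
    fderiv ℝ (fun y => jbr y t) = fun x => jbr x (t - 2) • (t • innerSL ℝ x) := by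
  ext1 x
  rw [(jbr_hasFDerivAt t x).fderiv, smul_smul, mul_comm]

lemma norm_iteratedFDeriv_clm_le {F : Type*} [NormedAddCommGroup F] [NormedSpace ℝ F]
    (L : Plane →L[ℝ] F) (n : ℕ) :
    ∃ C : ℝ, 0 ≤ C ∧ ∀ x : Plane, ‖iteratedFDeriv ℝ n L x‖ ≤ C * jbr x (1 - n) := by
  rcases n with _ | _ | n
  · refine ⟨‖L‖, norm_nonneg _, fun x => ?_⟩
    simp only [norm_iteratedFDeriv_zero, Nat.cast_zero, sub_zero]
    exact (L.le_opNorm x).trans (by gcongr; exact norm_le_jbr x)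
  · refine ⟨‖L‖, norm_nonneg _, fun x => ?_⟩
    rw [norm_iteratedFDeriv_one, L.fderiv]
    simp [jbr_zero]
  · refine ⟨0, le_rfl, fun x => ?_⟩
    rw [← norm_iteratedFDeriv_fderiv, ← norm_iteratedFDeriv_fderiv]
    have : fderiv ℝ (fderiv ℝ L) = fun _ => 0 := by
      have : fderiv ℝ L = fun _ => L := by ext1 x; exact L.fderiv
      rw [this]; ext1 x; simp
    rw [this]
    simp

lemma norm_iteratedFDeriv_jbr_le (n : ℕ) : ∀ t : ℝ, ∃ C : ℝ, 0 ≤ C ∧ ∀ x : Plane,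
    ‖iteratedFDeriv ℝ n (fun y => jbr y t) x‖ ≤ C * jbr x (t - n) := by
  induction n using Nat.strong_induction_on with
  | _ n ih =>
    intro t
    rcases n with _ | n
    · exact ⟨1, zero_le_one, fun x => by
        simp [norm_iteratedFDeriv_zero, abs_of_pos (jbr_pos x t)]⟩
    · have h1 : ∀ i, ∃ C : ℝ, 0 ≤ C ∧ (i ≤ n → ∀ x : Plane,
          ‖iteratedFDeriv ℝ i (fun y => jbr y (t - 2)) x‖ ≤ C * jbr x (t - 2 - i)) := by
        intro i
        by_cases hi : i ≤ n
        · obtain ⟨C, hC, h⟩ := ih i (by omega) (t - 2)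
          exact ⟨C, hC, fun _ => h⟩
        · exact ⟨0, le_rfl, fun h => absurd h hi⟩
      choose A hA hA' using h1
      choose B hB hB' using norm_iteratedFDeriv_clm_le (t • innerSL ℝ (E := Plane))
      refine ⟨∑ i ∈ Finset.range (n + 1), (n.choose i : ℝ) * A i * B (n - i),
        Finset.sum_nonneg fun i _ => by have := hA i; have := hB (n - i); positivity, fun x => ?_⟩
      rw [← norm_iteratedFDeriv_fderiv, jbr_fderiv]
      have h2 := norm_iteratedFDeriv_smul_le (𝕜 := ℝ) (jbr_contDiff (t - 2))
        ((t • innerSL ℝ (E := Plane)).contDiff (n := ∞)) x (n := n)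
        (by exact_mod_cast le_top)
      refine h2.trans ?_
      rw [Finset.sum_mul]
      refine Finset.sum_le_sum fun i hi => ?_
      have hi' : i ≤ n := by simpa [Nat.lt_succ_iff] using hi
      have e : jbr x (t - 2 - i) * jbr x (1 - (n - i : ℕ)) = jbr x (t - (n + 1 : ℕ)) := by
        rw [jbr_mul]; congr 1; push_cast [Nat.cast_sub hi']; ring
      calc _ ≤ (n.choose i : ℝ) * (A i * jbr x (t - 2 - i)) * (B (n - i) * jbr x (1 - (n - i : ℕ))) := by
            gcongr
            · have := hA i; have := (jbr_pos x (t - 2 - i)).le; positivity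
            · exact hA' i hi' x
            · exact hB' (n - i) x
        _ = (n.choose i : ℝ) * A i * B (n - i) * (jbr x (t - 2 - i) * jbr x (1 - (n - i : ℕ))) := by ring
        _ = _ := by rw [e]

lemma integrable_jbr_neg_three : Integrable (fun y : Plane => jbr y (-3)) := by
  unfold jbr
  exact integrable_rpow_neg_one_add_norm_sq (by simp; norm_num)

/-- A family `p` of smooth functions, all of whose derivatives are dominated by the weight `g`,
uniformly in the parameter. -/
structure UBound {ι : Type*} (g : ι → Plane → ℝ) (p : ι → Plane → ℂ) : Prop where
  smooth : ∀ i, ContDiff ℝ ∞ (p i)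
  bound : ∀ n : ℕ, ∃ C : ℝ, 0 ≤ C ∧ ∀ i x, ‖iteratedFDeriv ℝ n (p i) x‖ ≤ C * g i x

namespace UBound
variable {ι : Type*} {g g' : ι → Plane → ℝ} {p q : ι → Plane → ℂ}

lemma mono (hp : UBound g p) {c : ℝ} (hc : 0 ≤ c) (h : ∀ i x, g i x ≤ c * g' i x) :
    UBound g' p := by
  refine ⟨hp.smooth, fun n => ?_⟩
  obtain ⟨C, hC, h'⟩ := hp.bound n
  refine ⟨C * c, by positivity, fun i x => (h' i x).trans ?_⟩
  rw [mul_assoc]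
  exact mul_le_mul_of_nonneg_left (h i x) hC

lemma mul (hp : UBound g p) (hq : UBound g' q) (hg : ∀ i x, 0 ≤ g i x) :
    UBound (fun i x => g i x * g' i x) (fun i x => p i x * q i x) := by
  refine ⟨fun i => (hp.smooth i).mul (hq.smooth i), fun n => ?_⟩
  choose A hA hA' using hp.bound
  choose B hB hB' using hq.bound
  refine ⟨∑ i ∈ Finset.range (n + 1), (n.choose i : ℝ) * A i * B (n - i),
    Finset.sum_nonneg fun i _ => by have := hA i; have := hB (n - i); positivity, fun i x => ?_⟩
  refine (norm_iteratedFDeriv_mul_le (hp.smooth i) (hq.smooth i) x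
    (by exact_mod_cast le_top)).trans ?_
  rw [Finset.sum_mul]
  refine Finset.sum_le_sum fun j _ => ?_
  calc _ ≤ (n.choose j : ℝ) * (A j * g i x) * (B (n - j) * g' i x) := by
        gcongr
        · have := hA j; have := hg i x; positivity
        · exact hA' j i x
        · exact hB' (n - j) i x
    _ = _ := by ring

lemma temperate (hp : UBound g p) (hg : ∀ i x, g i x ≤ 1) (i : ι) :
    (p i).HasTemperateGrowth := by
  refine ⟨hp.smooth i, fun n => ?_⟩
  obtain ⟨C, hC, h⟩ := hp.bound n
  exact ⟨0, C, fun x => by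
    simpa using (h i x).trans (mul_le_mul_of_nonneg_left (hg i x) hC)⟩

end UBound

section Decay
variable {ι : Type*} {c : ι → Plane} {a : ι → Plane → ℂ}

lemma UBound.integrable_iteratedFDeriv (ha : UBound (fun i x => jbr (x - c i) (-3)) a)
    (n : ℕ) (i : ι) : Integrable (iteratedFDeriv ℝ n (a i)) := by
  obtain ⟨C, -, h⟩ := ha.bound n
  refine Integrable.mono' ((integrable_jbr_neg_three.comp_sub_right (c i)).const_mul C)
    ((ha.smooth i).continuous_iteratedFDeriv (by exact_mod_cast le_top)).aestronglyMeasurable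
    (.of_forall fun x => h i x)

lemma UBound.integrable (ha : UBound (fun i x => jbr (x - c i) (-3)) a) (i : ι) :
    Integrable (a i) := by
  obtain ⟨C, -, h⟩ := ha.bound 0
  refine Integrable.mono' ((integrable_jbr_neg_three.comp_sub_right (c i)).const_mul C)
    (ha.smooth i).continuous.aestronglyMeasurable (.of_forall fun x => ?_)
  simpa using h i x

lemma UBound.fourier_decay (ha : UBound (fun i x => jbr (x - c i) (-3)) a) (r : ℝ) :
    ∃ C : ℝ, 0 ≤ C ∧ ∀ i ζ, ‖𝓕 (a i) ζ‖ ≤ C * jbr ζ (-r) := by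
  have key : ∀ n : ℕ, ∃ C : ℝ, 0 ≤ C ∧ ∀ i ζ, ‖ζ‖ ^ n * ‖𝓕 (a i) ζ‖ ≤ C := by
    intro n
    choose C hC h using ha.bound
    set I := ∫ y : Plane, jbr y (-3)
    have hI : 0 ≤ I := integral_nonneg fun y => (jbr_pos y _).le
    refine ⟨2 ^ n * ∑ p ∈ Finset.range (n + 1), C p * I, ?_,
      fun i ζ => ?_⟩
    · exact mul_nonneg (by positivity) (Finset.sum_nonneg fun p _ => mul_nonneg (hC p) hI)
    have h1 := Real.pow_mul_norm_iteratedFDeriv_fourier_le (f := a i) (K := 0) (N := (⊤ : ℕ∞)) (k := 0) (n := n)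
      (ha.smooth i) (fun k m hk _ => by
        have : k = 0 := by exact_mod_cast (nonpos_iff_eq_zero.1 hk)
        subst this
        simpa using (ha.integrable_iteratedFDeriv m i).norm) (by simp)
        (by exact_mod_cast le_top) ζ
    simp only [norm_iteratedFDeriv_zero] at h1
    refine h1.trans ?_
    simp only [pow_zero, one_mul]
    simp
    gcongr with p hp
    calc _ ≤ ∫ y, C p * jbr (y - c i) (-3) :=
          integral_mono (ha.integrable_iteratedFDeriv p i).norm
            ((integrable_jbr_neg_three.comp_sub_right (c i)).const_mul _) fun y => h p i y
      _ = _ := by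
          rw [integral_const_mul, integral_sub_right_eq_self (fun y => jbr y (-3))]
  obtain ⟨N, hN⟩ := exists_nat_ge r
  obtain ⟨C0, hC0, h0⟩ := key 0
  obtain ⟨C1, hC1, h1⟩ := key (2 * N)
  refine ⟨2 ^ N * (C0 + C1), by positivity, fun i ζ => ?_⟩
  rw [jbr_neg, ← div_eq_mul_inv, le_div_iff₀ (jbr_pos _ _)]
  have h2 : jbr ζ r ≤ 2 ^ N * (1 + ‖ζ‖ ^ (2 * N)) := by
    calc jbr ζ r ≤ jbr ζ (2 * N) := jbr_mono _ (by
          have : (0 : ℝ) ≤ N := by positivity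
          linarith)
      _ = (1 + ‖ζ‖ ^ 2) ^ N := jbr_two_mul ζ N
      _ ≤ 2 ^ (N - 1) * (1 ^ N + (‖ζ‖ ^ 2) ^ N) := add_pow_le zero_le_one (by positivity) N
      _ ≤ 2 ^ N * (1 ^ N + (‖ζ‖ ^ 2) ^ N) := by
          gcongr
          · norm_num
          · omega
      _ = _ := by rw [one_pow, pow_mul]
  have h3 := h0 i ζ
  have h4 := h1 i ζ
  calc ‖𝓕 (a i) ζ‖ * jbr ζ r ≤ ‖𝓕 (a i) ζ‖ * (2 ^ N * (1 + ‖ζ‖ ^ (2 * N))) := by gcongr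
    _ = 2 ^ N * (‖ζ‖ ^ 0 * ‖𝓕 (a i) ζ‖ + ‖ζ‖ ^ (2 * N) * ‖𝓕 (a i) ζ‖) := by ring
    _ ≤ _ := by gcongr

lemma continuous_fourier_of_integrable {f : Plane → ℂ} (hf : Integrable f) : Continuous (𝓕 f) :=
  VectorFourier.fourierIntegral_continuous Real.continuous_fourierChar
    (by exact continuous_inner) hf

lemma UBound.integrable_fourier (ha : UBound (fun i x => jbr (x - c i) (-3)) a) (i : ι) :
    Integrable (𝓕 (a i)) := by
  obtain ⟨C, -, h⟩ := ha.fourier_decay 3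
  exact Integrable.mono' (integrable_jbr_neg_three.const_mul C)
    (continuous_fourier_of_integrable (ha.integrable i)).aestronglyMeasurable
    (.of_forall fun x => h i x)

end Decay

/-- The Fourier transform turns products into convolutions. -/
lemma fourier_mul_eq_integral {a f : Plane → ℂ} (hac : Continuous a) (ha : Integrable a)
    (ha' : Integrable (𝓕 a)) (hf : Integrable f) (ξ : Plane) :
    𝓕 (fun x => a x * f x) ξ = ∫ η, 𝓕 a η * 𝓕 f (ξ - η) := by
  have hinv : ∀ x, a x = 𝓕 (𝓕 a) (-x) := fun x => by
    rw [← Real.fourierInv_eq_fourier_neg]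
    exact (congrFun (hac.fourierInv_fourier_eq ha ha') x).symm
  set g : Plane → ℂ := fun x => Real.fourierChar (inner ℝ x ξ) • f (-x) with hg
  have hgi : Integrable g := by
    have h1 : Integrable (fun x => f (-x)) := hf.comp_neg
    refine h1.norm.mono' ?_ (.of_forall fun x => by simp [hg])
    exact (Real.continuous_fourierChar.comp
      (continuous_id.inner continuous_const)).aestronglyMeasurable.smul h1.aestronglyMeasurable
  have hgf : ∀ η, 𝓕 g η = 𝓕 f (ξ - η) := fun η => by
    rw [Real.fourier_eq, Real.fourier_eq,
      ← integral_neg_eq_self (fun v => Real.fourierChar (-inner ℝ v (ξ - η)) • f v)]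
    congr 1; ext1 v
    simp only [hg, smul_smul, ← AddChar.map_add_eq_mul]
    congr 2
    simp [inner_sub_right, inner_neg_left]
  calc 𝓕 (fun x => a x * f x) ξ = ∫ x, 𝓕 (𝓕 a) x * g x := by
        rw [Real.fourier_eq, ← integral_neg_eq_self]
        congr 1; ext1 x
        rw [hinv (-x), neg_neg, hg]
        simp only [inner_neg_left, neg_neg, Circle.smul_def, smul_eq_mul]
        ring
    _ = ∫ x, 𝓕 a x * 𝓕 g x := by
        have := VectorFourier.integral_fourierIntegral_smul_eq_flip (L := innerₗ Plane)
          Real.continuous_fourierChar (by exact continuous_inner) ha' hgi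
        rw [flip_innerₗ] at this
        exact this
    _ = _ := by simp_rw [hgf]

/-- Parameters: the semiclassical parameter `h ∈ (0, 1)` and the centre of a window. -/
abbrev Par := Set.Ioo (0 : ℝ) 1 × Plane

/-- Functions concentrated at the centre, decaying faster than any power. -/
def IsRapid (a : Par → Plane → ℂ) : Prop :=
  ∀ r : ℝ, UBound (fun i x => jbr (x - i.2) (-r)) a

/-- Functions decaying cubically away from the centre. -/
def IsTame (a : Par → Plane → ℂ) : Prop :=
  UBound (fun i x => jbr (x - i.2) (-3)) a

/-- Symbols of size `h ⟨hξ⟩⁻²`. -/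
def IsSmallSymbol (p : Par → Plane → ℂ) : Prop :=
  UBound (fun i x => i.1 * jbr (i.1.1 • x) (-2)) p

/-- Temperate symbols whose first derivatives are of size `h ⟨hξ⟩⁻²`. -/
def IsSlowSymbol (p : Par → Plane → ℂ) : Prop :=
  (∀ i, (p i).HasTemperateGrowth) ∧
    ∀ m : Plane, IsSmallSymbol (fun i x => fderiv ℝ (p i) x m)

lemma jbr_le_one (y : Plane) {t : ℝ} (h : t ≤ 0) : jbr y t ≤ 1 := by
  simpa [jbr_zero] using jbr_mono y h

lemma IsTame.temperate {a : Par → Plane → ℂ} (ha : IsTame a) (i : Par) :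
    (a i).HasTemperateGrowth :=
  UBound.temperate ha (fun _ _ => jbr_le_one _ (by norm_num)) i

lemma IsRapid.isTame {a : Par → Plane → ℂ} (ha : IsRapid a) : IsTame a := ha 3

lemma IsSmallSymbol.temperate {p : Par → Plane → ℂ} (hp : IsSmallSymbol p) (i : Par) :
    (p i).HasTemperateGrowth := by
  refine UBound.temperate hp (fun i x => ?_) i
  have h1 := jbr_le_one (i.1.1 • x) (t := -2) (by norm_num)
  exact mul_le_one₀ i.1.2.2.le (jbr_pos _ _).le h1

lemma IsSmallSymbol.fderiv_apply {p : Par → Plane → ℂ} (hp : IsSmallSymbol p) (m : Plane) :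
    IsSmallSymbol (fun i x => fderiv ℝ (p i) x m) := by
  have hs : ∀ i, ContDiff ℝ ∞ (fderiv ℝ (p i)) := fun i =>
    (hp.smooth i).fderiv_right (by simp)
  refine ⟨fun i => (hs i).clm_apply contDiff_const, fun n => ?_⟩
  obtain ⟨C, hC, h⟩ := hp.bound (n + 1)
  refine ⟨‖m‖ * C, by positivity, fun i x => ?_⟩
  refine (norm_iteratedFDeriv_clm_apply_const (hs i).contDiffAt
    (by exact_mod_cast le_top)).trans ?_
  rw [norm_iteratedFDeriv_fderiv, mul_assoc]
  exact mul_le_mul_of_nonneg_left (h i x) (norm_nonneg _)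

lemma IsSmallSymbol.isSlowSymbol {p : Par → Plane → ℂ} (hp : IsSmallSymbol p) :
    IsSlowSymbol p := ⟨hp.temperate, hp.fderiv_apply⟩

lemma uBound_inner (m : Plane) :
    UBound (fun (i : Par) x => jbr (x - i.2) 1)
      (fun i x => ((inner ℝ (x - i.2) m : ℝ) : ℂ)) := by
  set L : Plane →L[ℝ] ℂ := Complex.ofRealCLM ∘L (innerSL ℝ m) with hL
  have e : ∀ i : Par, (fun x => ((inner ℝ (x - i.2) m : ℝ) : ℂ)) = fun x => L (x - i.2) := by
    intro i; ext1 x; simp [hL, real_inner_comm]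
  refine ⟨fun i => ?_, fun n => ?_⟩
  · rw [e]
    exact L.contDiff.comp (contDiff_id.sub contDiff_const)
  · obtain ⟨C, hC, h⟩ := norm_iteratedFDeriv_clm_le L n
    refine ⟨C, hC, fun i x => ?_⟩
    rw [e, iteratedFDeriv_comp_sub]
    refine (h _).trans (mul_le_mul_of_nonneg_left (jbr_mono _ ?_) hC)
    simp

lemma IsRapid.inner_mul {a : Par → Plane → ℂ} (ha : IsRapid a) (m : Plane) :
    IsRapid (fun i x => ((inner ℝ (x - i.2) m : ℝ) : ℂ) * a i x) := by
  intro r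
  refine ((uBound_inner m).mul (ha (r + 1)) fun i x => (jbr_pos _ _).le).mono zero_le_one ?_
  intro i x
  rw [jbr_mul, one_mul]
  exact jbr_mono _ (by linarith)

lemma temperate_inner (k m : Plane) :
    (fun x => ((inner ℝ (x - k) m : ℝ) : ℂ)).HasTemperateGrowth := by
  have h := UBound.smooth (uBound_inner m) (⟨⟨1 / 2, by norm_num⟩, k⟩ : Par)
  refine ⟨h, fun n => ?_⟩
  obtain ⟨C, hC, hb⟩ := (uBound_inner m).bound n
  refine ⟨1, C * (1 + ‖k‖), fun x => ?_⟩
  refine (hb (⟨⟨1 / 2, by norm_num⟩, k⟩ : Par) x).trans ?_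
  rw [mul_assoc]
  refine mul_le_mul_of_nonneg_left ?_ hC
  dsimp only
  have h1 : jbr (x - k) 1 ≤ 1 + ‖x - k‖ := by
    unfold jbr
    rw [← Real.sqrt_eq_rpow]
    exact Real.sqrt_le_iff.2 ⟨by positivity, by nlinarith [norm_nonneg (x - k)]⟩
  have h2 := norm_sub_le x k
  nlinarith [norm_nonneg x, norm_nonneg k]

/-- Families of operators on Schwartz space. -/
abbrev OpFam := Par → (𝓢(Plane, ℂ) →L[ℂ] 𝓢(Plane, ℂ))

/-- Multiplication by a family of functions. -/
noncomputable def mulOp (a : Par → Plane → ℂ) : OpFam := fun i => SchwartzMap.smulLeftCLM ℂ (a i)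

/-- The Fourier multipliers of a family of symbols. -/
noncomputable def multOp (p : Par → Plane → ℂ) : OpFam :=
  fun i => SchwartzMap.fourierMultiplierCLM ℂ (p i)

/-- Multiplication by a coordinate relative to the centre. -/
noncomputable def posOp (m : Plane) : OpFam :=
  mulOp fun i x => ((inner ℝ (x - i.2) m : ℝ) : ℂ)

lemma posOp_mul_mulOp (m : Plane) {a : Par → Plane → ℂ} (ha : ∀ i, (a i).HasTemperateGrowth) :
    posOp m * mulOp a = mulOp (fun i x => ((inner ℝ (x - i.2) m : ℝ) : ℂ) * a i x) := by
  ext1 i; ext1 f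
  exact SchwartzMap.smulLeftCLM_smulLeftCLM_apply (temperate_inner i.2 m) (ha i) f

lemma mulOp_comm {a b : Par → Plane → ℂ} (ha : ∀ i, (a i).HasTemperateGrowth)
    (hb : ∀ i, (b i).HasTemperateGrowth) : mulOp a * mulOp b = mulOp b * mulOp a := by
  ext1 i; ext1 f
  refine (SchwartzMap.smulLeftCLM_smulLeftCLM_apply (ha i) (hb i) f).trans ?_
  rw [mul_comm]
  exact (SchwartzMap.smulLeftCLM_smulLeftCLM_apply (hb i) (ha i) f).symm

lemma posOp_mul_multOp (m : Plane) {p : Par → Plane → ℂ} (hp : IsSlowSymbol p) :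
    posOp m * multOp p = multOp p * posOp m +
      (-(2 * Real.pi * Complex.I))⁻¹ • multOp (fun i x => fderiv ℝ (p i) x m) := by
  have hc : (-(2 * Real.pi * Complex.I)) ≠ 0 := by simp [Real.pi_ne_zero]
  set c : ℂ := -(2 * Real.pi * Complex.I)
  ext1 i; ext1 f
  set Q : 𝓢(Plane, ℂ) →L[ℝ] 𝓢(Plane, ℂ) :=
    SchwartzMap.smulLeftCLM ℂ (fun x : Plane => (inner ℝ x m : ℝ)) with hQ
  have hX : ∀ g : 𝓢(Plane, ℂ), posOp m i g = Q g - ((inner ℝ i.2 m : ℝ) : ℂ) • g := by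
    intro g; ext x
    rw [posOp, mulOp, SchwartzMap.smulLeftCLM_apply_apply (temperate_inner i.2 m),
      sub_apply, smul_apply, hQ,
      SchwartzMap.smulLeftCLM_apply_apply (Function.hasTemperateGrowth_inner_left m)]
    simp [inner_sub_left]; ring
  have hd : ∀ g : 𝓢(Plane, ℂ), LineDeriv.lineDerivOp m (SchwartzMap.smulLeftCLM ℂ (p i) g)
      = SchwartzMap.smulLeftCLM ℂ (fun x => fderiv ℝ (p i) x m) g
        + SchwartzMap.smulLeftCLM ℂ (p i) (LineDeriv.lineDerivOp m g) := by
    intro g; ext x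
    have e : ⇑(SchwartzMap.smulLeftCLM ℂ (p i) g) = fun x => p i x * g x := by
      ext1 x; rw [SchwartzMap.smulLeftCLM_apply_apply (hp.1 i)]; rfl
    rw [SchwartzMap.lineDerivOp_apply_eq_fderiv, e, add_apply,
      SchwartzMap.smulLeftCLM_apply_apply ((hp.2 m).temperate i),
      SchwartzMap.smulLeftCLM_apply_apply (hp.1 i), SchwartzMap.lineDerivOp_apply_eq_fderiv,
      fderiv_fun_mul ((hp.1 i).1.differentiable (by simp) x) g.differentiableAt]
    simp; ring
  have hM : ∀ (q : Par → Plane → ℂ) (g : 𝓢(Plane, ℂ)),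
      multOp q i g = 𝓕⁻ (SchwartzMap.smulLeftCLM ℂ (q i) (𝓕 g)) := fun q g =>
    SchwartzMap.fourierMultiplierCLM_apply _ _
  have h1 : Q (multOp p i f) = c⁻¹ • multOp (fun i x => fderiv ℝ (p i) x m) i f
      + multOp p i (Q f) := by
    have h2 := SchwartzMap.fourierInv_lineDerivOp_eq (SchwartzMap.smulLeftCLM ℂ (p i) (𝓕 f)) m
    rw [← hM, hd, SchwartzMap.lineDerivOp_fourier_eq, FourierTransform.fourierInv_add,
      FourierTransform.fourier_smul, map_smul, FourierTransform.fourierInv_smul, ← hM,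
      ← hM (fun i x => fderiv ℝ (p i) x m)] at h2
    change _ = c • Q (multOp p i f) at h2
    rw [← inv_smul_smul₀ hc (Q (multOp p i f)), ← h2, smul_add, inv_smul_smul₀ hc]
  change posOp m i (multOp p i f) = multOp p i (posOp m i f) + c⁻¹ • multOp _ i f
  rw [hX, hX, h1, map_sub, map_smul]
  abel

/-- The span of the elementary operators which gain `h` and two derivatives. -/
noncomputable def gaining : Submodule ℂ OpFam := Submodule.span ℂ
  ({T | ∃ p a, IsSmallSymbol p ∧ IsRapid a ∧ T = multOp p * mulOp a} ∪
    {T | ∃ p β a, IsSlowSymbol p ∧ IsTame β ∧ IsRapid a ∧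
      T = (multOp p * mulOp β - mulOp β * multOp p) * mulOp a})

lemma multOp_mul_mem {p a : Par → Plane → ℂ} (hp : IsSmallSymbol p) (ha : IsRapid a) :
    multOp p * mulOp a ∈ gaining :=
  Submodule.subset_span (.inl ⟨p, a, hp, ha, rfl⟩)

lemma commutator_mul_mem {p β a : Par → Plane → ℂ} (hp : IsSlowSymbol p) (hβ : IsTame β)
    (ha : IsRapid a) : (multOp p * mulOp β - mulOp β * multOp p) * mulOp a ∈ gaining :=
  Submodule.subset_span (.inr ⟨p, β, a, hp, hβ, ha, rfl⟩)

lemma posOp_mul_mem (m : Plane) {T : OpFam} (hT : T ∈ gaining) : posOp m * T ∈ gaining := by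
  induction hT using Submodule.span_induction with
  | zero => simp
  | add S T _ _ hS hT => rw [mul_add]; exact add_mem hS hT
  | smul c T _ hT => rw [mul_smul_comm]; exact Submodule.smul_mem _ _ hT
  | mem T hT =>
    rcases hT with ⟨p, a, hp, ha, rfl⟩ | ⟨p, β, a, hp, hβ, ha, rfl⟩
    · rw [← mul_assoc, posOp_mul_multOp m hp.isSlowSymbol, add_mul, mul_assoc,
        posOp_mul_mulOp m ha.isTame.temperate, smul_mul_assoc]
      exact add_mem (multOp_mul_mem hp (ha.inner_mul m))
        (Submodule.smul_mem _ _ (multOp_mul_mem (hp.fderiv_apply m) ha))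
    · have h1 := posOp_mul_multOp m hp
      have h2 : posOp m * mulOp β = mulOp β * posOp m :=
        mulOp_comm (fun i => temperate_inner i.2 m) hβ.temperate
      have h3 := posOp_mul_mulOp m ha.isTame.temperate
      set c : ℂ := (-(2 * Real.pi * Complex.I))⁻¹
      set p' : Par → Plane → ℂ := fun i x => fderiv ℝ (p i) x m
      have e : posOp m * ((multOp p * mulOp β - mulOp β * multOp p) * mulOp a) =
          (multOp p * mulOp β - mulOp β * multOp p) * (posOp m * mulOp a) +
          c • ((multOp p' * mulOp β - mulOp β * multOp p') * mulOp a) := by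
        have h1' : ∀ S, posOp m * (multOp p * S)
            = multOp p * (posOp m * S) + c • (multOp p' * S) := fun S => by
          rw [← mul_assoc, h1, add_mul, mul_assoc, smul_mul_assoc]
        have h2' : ∀ S, posOp m * (mulOp β * S) = mulOp β * (posOp m * S) := fun S => by
          rw [← mul_assoc, h2, mul_assoc]
        simp only [sub_mul, mul_sub, mul_add, mul_assoc, h1', h2', smul_sub, mul_smul_comm]
        abel
      rw [e, h3]
      exact add_mem (commutator_mul_mem hp hβ (ha.inner_mul m)) (Submodule.smul_mem _ _
        (commutator_mul_mem (hp.2 m).isSlowSymbol hβ ha))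

/-- Multiplication by `1 + |x - k|²`. -/
noncomputable def weightOp : OpFam :=
  1 + ∑ j : Fin 2, posOp (EuclideanSpace.single j 1) * posOp (EuclideanSpace.single j 1)

lemma weightOp_mul_mem {T : OpFam} (hT : T ∈ gaining) : weightOp * T ∈ gaining := by
  rw [weightOp, add_mul, one_mul, Finset.sum_mul]
  refine add_mem hT (sum_mem fun j _ => ?_)
  rw [mul_assoc]
  exact posOp_mul_mem _ (posOp_mul_mem _ hT)

lemma weightOp_pow_mul_mem {T : OpFam} (hT : T ∈ gaining) (n : ℕ) :
    weightOp ^ n * T ∈ gaining := by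
  induction n with
  | zero => simpa
  | succ n ih => rw [pow_succ', mul_assoc]; exact weightOp_mul_mem ih

lemma norm_iteratedFDeriv_ofReal {f : Plane → ℝ} (hf : ContDiff ℝ ∞ f) (n : ℕ) (x : Plane) :
    ‖iteratedFDeriv ℝ n (fun y => (f y : ℂ)) x‖ = ‖iteratedFDeriv ℝ n f x‖ :=
  Complex.ofRealLI.norm_iteratedFDeriv_comp_left hf.contDiffAt (by exact_mod_cast le_top)

lemma uBound_jbr {ι : Type*} (c : ι → Plane) (t : ℝ) :
    UBound (fun i x => jbr (x - c i) t) (fun i x => (jbr (x - c i) t : ℂ)) := by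
  have hs : ∀ i, ContDiff ℝ ∞ (fun x => jbr (x - c i) t) := fun i =>
    (jbr_contDiff t).comp (contDiff_id.sub contDiff_const)
  refine ⟨fun i => Complex.ofRealCLM.contDiff.comp (hs i), fun n => ?_⟩
  obtain ⟨C, hC, h⟩ := norm_iteratedFDeriv_jbr_le n t
  refine ⟨C, hC, fun i x => ?_⟩
  rw [norm_iteratedFDeriv_ofReal (hs i), iteratedFDeriv_comp_sub (f := fun y => jbr y t)]
  exact (h _).trans (mul_le_mul_of_nonneg_left (jbr_mono _ (by simp)) hC)

lemma weightOp_apply (i : Par) (g : 𝓢(Plane, ℂ)) (x : Plane) :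
    weightOp i g x = (jbr (x - i.2) 2 : ℂ) * g x := by
  have h1 : ∀ (m : Plane) (g : 𝓢(Plane, ℂ)),
      posOp m i g x = ((inner ℝ (x - i.2) m : ℝ) : ℂ) * g x := fun m g =>
    SchwartzMap.smulLeftCLM_apply_apply (temperate_inner i.2 m) g x
  have h2 : weightOp i g = g + ∑ j : Fin 2, posOp (EuclideanSpace.single j 1) i
      (posOp (EuclideanSpace.single j 1) i g) := by
    simp [weightOp]
  rw [h2, Fin.sum_univ_two, add_apply, add_apply, h1, h1, h1, h1, jbr_two,
    EuclideanSpace.norm_sq_eq, Fin.sum_univ_two]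
  simp [EuclideanSpace.inner_single_right]
  ring

lemma weightOp_pow_apply (n : ℕ) (i : Par) (g : 𝓢(Plane, ℂ)) (x : Plane) :
    (weightOp ^ n) i g x = (jbr (x - i.2) (2 * n) : ℂ) * g x := by
  induction n with
  | zero => simp [jbr_zero]
  | succ n ih =>
    rw [pow_succ']
    change weightOp i ((weightOp ^ n) i g) x = _
    rw [weightOp_apply, ih, ← mul_assoc, ← Complex.ofReal_mul, jbr_mul]
    congr 3; push_cast; ring

lemma IsRapid.jbr_mul {a : Par → Plane → ℂ} (ha : IsRapid a) (t : ℝ) :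
    IsRapid fun i x => (jbr (x - i.2) t : ℂ) * a i x := by
  intro r
  refine ((uBound_jbr _ t).mul (ha (r + t)) fun i x => (jbr_pos _ _).le).mono zero_le_one ?_
  intro i x
  rw [Scl.jbr_mul, one_mul]
  exact jbr_mono _ (by linarith)

/-- Multiplying a rapidly decaying family by the weight. -/
lemma weightOp_mul_mulOp {a : Par → Plane → ℂ} (ha : IsRapid a) :
    weightOp * mulOp a = mulOp fun i x => (jbr (x - i.2) 2 : ℂ) * a i x := by
  ext i f x
  change weightOp i (mulOp a i f) x = _
  rw [weightOp_apply, mulOp, mulOp, SchwartzMap.smulLeftCLM_apply_apply (ha.isTame.temperate i),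
    SchwartzMap.smulLeftCLM_apply_apply ((ha.jbr_mul 2).isTame.temperate i), smul_eq_mul,
    smul_eq_mul, mul_assoc]

lemma commutator_posOp_mul_mem (m : Plane) {p a : Par → Plane → ℂ} (hp : IsSlowSymbol p)
    (ha : IsRapid a) : (multOp p * posOp m - posOp m * multOp p) * mulOp a ∈ gaining := by
  rw [posOp_mul_multOp m hp, sub_add_cancel_left, neg_mul, smul_mul_assoc]
  exact neg_mem (Submodule.smul_mem _ _ (multOp_mul_mem (hp.2 m) ha))

lemma commutator_weightOp_mul_mem {p a : Par → Plane → ℂ} (hp : IsSlowSymbol p)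
    (ha : IsRapid a) : (multOp p * weightOp - weightOp * multOp p) * mulOp a ∈ gaining := by
  have e : (multOp p * weightOp - weightOp * multOp p) * mulOp a =
      ∑ j : Fin 2, ((multOp p * posOp (EuclideanSpace.single j 1)
          - posOp (EuclideanSpace.single j 1) * multOp p)
            * (posOp (EuclideanSpace.single j 1) * mulOp a)
        + posOp (EuclideanSpace.single j 1) * ((multOp p * posOp (EuclideanSpace.single j 1)
          - posOp (EuclideanSpace.single j 1) * multOp p) * mulOp a)) := by
    simp only [weightOp, Fin.sum_univ_two]
    noncomm_ring
  rw [e]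
  refine sum_mem fun j _ => add_mem ?_ (posOp_mul_mem _ (commutator_posOp_mul_mem _ hp ha))
  rw [posOp_mul_mulOp _ ha.isTame.temperate]
  exact commutator_posOp_mul_mem _ hp (ha.inner_mul _)

lemma commutator_weightOp_pow_mul_mem {p : Par → Plane → ℂ} (hp : IsSlowSymbol p) (n : ℕ) :
    ∀ {a : Par → Plane → ℂ}, IsRapid a →
      (multOp p * weightOp ^ n - weightOp ^ n * multOp p) * mulOp a ∈ gaining := by
  induction n with
  | zero => intro a _; simp
  | succ n ih =>
    intro a ha
    have e : (multOp p * weightOp ^ (n + 1) - weightOp ^ (n + 1) * multOp p) * mulOp a =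
        (multOp p * weightOp ^ n - weightOp ^ n * multOp p) * (weightOp * mulOp a)
        + weightOp ^ n * ((multOp p * weightOp - weightOp * multOp p) * mulOp a) := by
      rw [pow_succ]
      noncomm_ring
    rw [e, weightOp_mul_mulOp ha]
    exact add_mem (ih (ha.jbr_mul 2)) (weightOp_pow_mul_mem (commutator_weightOp_mul_mem hp ha) n)

/-- The weighted commutator with a function of polynomial growth gains. -/
lemma weightOp_pow_commutator_mem {p β a : Par → Plane → ℂ} (hp : IsSlowSymbol p)
    (hβ : IsTame β) (ha : IsRapid a) (hβa : IsRapid fun i x => β i x * a i x) (n : ℕ) :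
    weightOp ^ n * ((multOp p * (weightOp ^ n * mulOp β)
      - (weightOp ^ n * mulOp β) * multOp p) * mulOp a) ∈ gaining := by
  have e1 : mulOp β * mulOp a = mulOp fun i x => β i x * a i x := by
    ext1 i; ext1 f
    exact SchwartzMap.smulLeftCLM_smulLeftCLM_apply (hβ.temperate i) (ha.isTame.temperate i) f
  have e : (multOp p * (weightOp ^ n * mulOp β) - (weightOp ^ n * mulOp β) * multOp p) * mulOp a
      = (multOp p * weightOp ^ n - weightOp ^ n * multOp p) * (mulOp β * mulOp a)
      + weightOp ^ n * ((multOp p * mulOp β - mulOp β * multOp p) * mulOp a) := by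
    noncomm_ring
  rw [e, e1]
  exact weightOp_pow_mul_mem (add_mem (commutator_weightOp_pow_mul_mem hp n hβa)
    (weightOp_pow_mul_mem (commutator_mul_mem hp hβ ha) n)) n

lemma lintegral_mul_sq_le {α : Type*} [MeasurableSpace α] {μ : Measure α} {f g : α → ℝ≥0∞}
    (hf : AEMeasurable f μ) (hg : AEMeasurable g μ) :
    (∫⁻ x, f x * g x ∂μ) ^ 2 ≤ (∫⁻ x, f x ^ 2 ∂μ) * ∫⁻ x, g x ^ 2 ∂μ := by
  have h := ENNReal.lintegral_mul_le_Lp_mul_Lq μ Real.HolderConjugate.two_two hf hg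
  have e : ∀ x : ℝ≥0∞, (x ^ (1 / 2 : ℝ)) ^ 2 = x := fun x => by
    rw [← ENNReal.rpow_natCast, ← ENNReal.rpow_mul]; simp
  calc _ ≤ ((∫⁻ x, f x ^ (2 : ℝ) ∂μ) ^ (1 / 2 : ℝ) * (∫⁻ x, g x ^ (2 : ℝ) ∂μ) ^ (1 / 2 : ℝ)) ^ 2 := by
        gcongr; exact h
    _ = _ := by rw [mul_pow, e, e]; simp

lemma eLpNorm_two_sq {α E : Type*} [MeasurableSpace α] [NormedAddCommGroup E] (μ : Measure α)
    (f : α → E) : eLpNorm f 2 μ ^ 2 = ∫⁻ x, ‖f x‖ₑ ^ 2 ∂μ := by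
  have := eLpNorm_nnreal_pow_eq_lintegral (μ := μ) (f := f) (p := 2) two_ne_zero
  simpa using this

/-- Young's inequality `L¹ * L² ⊆ L²`. -/
lemma eLpNorm_le_of_convolution_le {F G : Plane → ℂ} {K : Plane → ℝ≥0∞} (hK : Measurable K)
    (hG : Measurable G) (h : ∀ ξ, ‖F ξ‖ₑ ≤ ∫⁻ η, K (ξ - η) * ‖G η‖ₑ) :
    eLpNorm F 2 ≤ (∫⁻ ζ, K ζ) * eLpNorm G 2 := by
  have e : ∀ x : ℝ≥0∞, (x ^ (1 / 2 : ℝ)) ^ 2 = x := fun x => by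
    rw [← ENNReal.rpow_natCast, ← ENNReal.rpow_mul]; simp
  rw [← ENNReal.pow_le_pow_left_iff two_ne_zero, mul_pow, eLpNorm_two_sq, eLpNorm_two_sq]
  calc ∫⁻ ξ, ‖F ξ‖ₑ ^ 2 ≤ ∫⁻ ξ, (∫⁻ ζ, K ζ) * ∫⁻ η, K (ξ - η) * ‖G η‖ₑ ^ 2 := by
        refine lintegral_mono fun ξ => ?_
        have h1 : ∫⁻ η, K (ξ - η) * ‖G η‖ₑ
            = ∫⁻ η, K (ξ - η) ^ (1 / 2 : ℝ) * (K (ξ - η) ^ (1 / 2 : ℝ) * ‖G η‖ₑ) := by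
          congr 1; ext1 η
          rw [← mul_assoc, ← sq, e]
        calc ‖F ξ‖ₑ ^ 2 ≤ _ := pow_le_pow_left' ((h ξ).trans_eq h1) 2
          _ ≤ _ := lintegral_mul_sq_le (by fun_prop) (by fun_prop)
          _ = _ := by
            simp_rw [mul_pow, e]
            rw [lintegral_sub_left_eq_self K]
    _ = (∫⁻ ζ, K ζ) * ∫⁻ ξ, ∫⁻ η, K (ξ - η) * ‖G η‖ₑ ^ 2 := by
        rw [lintegral_const_mul]
        exact Measurable.lintegral_prod_right
          (f := fun ξ η : Plane => K (ξ - η) * ‖G η‖ₑ ^ 2) (by unfold Function.uncurry; fun_prop)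
    _ = (∫⁻ ζ, K ζ) * ∫⁻ η, ∫⁻ ξ, K (ξ - η) * ‖G η‖ₑ ^ 2 := by
        rw [lintegral_lintegral_swap]
        exact Measurable.aemeasurable (by unfold Function.uncurry; fun_prop)
    _ = _ := by
        have : ∀ η, ∫⁻ ξ, K (ξ - η) * ‖G η‖ₑ ^ 2 = (∫⁻ ζ, K ζ) * ‖G η‖ₑ ^ 2 := fun η => by
          rw [lintegral_mul_const _ (by fun_prop), lintegral_sub_right_eq_self K]
        simp_rw [this]
        rw [lintegral_const_mul _ (by fun_prop), sq, mul_assoc]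

/-- The semiclassical Sobolev norm, on the Fourier side. -/
noncomputable def sobNorm (h s : ℝ) (f : 𝓢(Plane, ℂ)) : ℝ≥0∞ :=
  eLpNorm (fun ξ => (jbr (h • ξ) s : ℂ) * 𝓕 f ξ) 2

lemma continuous_jbr (t : ℝ) : Continuous fun y => jbr y t := (jbr_contDiff t).continuous

lemma measurable_jbr_smul (h t : ℝ) : Measurable fun ξ : Plane => jbr (h • ξ) t :=
  ((continuous_jbr t).comp (continuous_const_smul h)).measurable

lemma jbr_smul_le {h : ℝ} (hh : h ∈ Set.Ioo (0 : ℝ) 1) (ξ : Plane) {t : ℝ} (ht : 0 ≤ t) :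
    jbr (h • ξ) t ≤ jbr ξ t := by
  refine jbr_le_of_norm_le ?_ ht
  rw [norm_smul, Real.norm_of_nonneg hh.1.le]
  exact mul_le_of_le_one_left (norm_nonneg _) hh.2.le

lemma jbr_smul_peetre {h : ℝ} (hh : h ∈ Set.Ioo (0 : ℝ) 1) (ξ η : Plane) (t : ℝ) :
    jbr (h • ξ) t ≤ 2 ^ (|t| / 2) * jbr (h • η) t * jbr (ξ - η) |t| := by
  refine (jbr_peetre (h • ξ) (h • η) t).trans ?_
  rw [← smul_sub]
  have := jbr_pos (h • η) t
  gcongr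
  exact jbr_smul_le hh _ (abs_nonneg t)

/-- A Schur test for operators given by a kernel on the Fourier side. -/
lemma sobNorm_le_of_kernel (s t : ℝ) : ∃ C : ℝ, 0 ≤ C ∧ ∀ (h : ℝ), h ∈ Set.Ioo (0 : ℝ) 1 →
    ∀ (f g : 𝓢(Plane, ℂ)) (k : Plane → Plane → ℂ) (A : ℝ), 0 ≤ A →
    (∀ ξ, 𝓕 g ξ = ∫ η, k ξ η * 𝓕 f η) →
    (∀ ξ η, ‖k ξ η‖ ≤ A * jbr (h • η) (s - t) * jbr (ξ - η) (-|t| - 3)) →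
    sobNorm h t g ≤ ENNReal.ofReal (C * A) * sobNorm h s f := by
  obtain ⟨c, hc, hpeetre⟩ : ∃ c : ℝ, 0 < c ∧ ∀ h ∈ Set.Ioo (0 : ℝ) 1, ∀ ξ η : Plane,
      jbr (h • ξ) t ≤ c * jbr (h • η) t * jbr (ξ - η) |t| :=
    ⟨2 ^ (|t| / 2), by positivity, fun h hh ξ η => jbr_smul_peetre hh ξ η t⟩
  refine ⟨c * ∫ ζ : Plane, jbr ζ (-3), mul_nonneg hc.le (integral_nonneg fun ζ => (jbr_pos _ _).le),
    fun h hh f g k A hA hg hk => ?_⟩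
  have h1 : ∀ ξ, ‖(jbr (h • ξ) t : ℂ) * 𝓕 g ξ‖ₑ ≤
      ∫⁻ η, ENNReal.ofReal (c * A * jbr (ξ - η) (-3)) * ‖(jbr (h • η) s : ℂ) * 𝓕 f η‖ₑ := by
    intro ξ
    rw [hg, ← integral_const_mul]
    refine (enorm_integral_le_lintegral_enorm _).trans (lintegral_mono fun η => ?_)
    rw [← ofReal_norm, ← ofReal_norm, ← ENNReal.ofReal_mul' (norm_nonneg _)]
    refine ENNReal.ofReal_le_ofReal ?_
    simp only [norm_mul, Complex.norm_real, Real.norm_of_nonneg (jbr_pos _ _).le]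
    have h2 := hpeetre h hh ξ η
    have h3 := hk ξ η
    have p1 := jbr_pos (h • η) t
    have p2 := jbr_pos (ξ - η) |t|
    calc jbr (h • ξ) t * (‖k ξ η‖ * ‖𝓕 f η‖) ≤ (c * jbr (h • η) t * jbr (ξ - η) |t|) *
          ((A * jbr (h • η) (s - t) * jbr (ξ - η) (-|t| - 3)) * ‖𝓕 f η‖) :=
          mul_le_mul h2 (mul_le_mul_of_nonneg_right h3 (norm_nonneg _))
            (mul_nonneg (norm_nonneg _) (norm_nonneg _)) (by positivity)
      _ = c * A * (jbr (ξ - η) |t| * jbr (ξ - η) (-|t| - 3)) *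
          ((jbr (h • η) t * jbr (h • η) (s - t)) * ‖𝓕 f η‖) := by ring
      _ = c * A * jbr (ξ - η) (-3) * (jbr (h • η) s * ‖𝓕 f η‖) := by
        rw [jbr_mul, jbr_mul, show |t| + (-|t| - 3) = -3 by ring, show t + (s - t) = s by ring]
  have h4 : Continuous fun ζ : Plane => jbr ζ (-3) := continuous_jbr _
  refine (eLpNorm_le_of_convolution_le (K := fun ζ => ENNReal.ofReal (c * A * jbr ζ (-3)))
    (h4.measurable.const_mul (c * A)).ennreal_ofReal ?_ h1).trans_eq ?_
  · exact ((measurable_jbr_smul h s).complex_ofReal).mul (𝓕 f).continuous.measurable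
  · rw [← ofReal_integral_eq_lintegral_ofReal (integrable_jbr_neg_three.const_mul _)
      (.of_forall fun ζ => mul_nonneg (mul_nonneg hc.le hA) (jbr_pos _ _).le), integral_const_mul]
    congr 2; ring

lemma mulOp_apply {a : Par → Plane → ℂ} (ha : IsTame a) (i : Par) (f : 𝓢(Plane, ℂ)) (x : Plane) :
    mulOp a i f x = a i x * f x :=
  SchwartzMap.smulLeftCLM_apply_apply (ha.temperate i) f x

lemma fourier_mulOp {a : Par → Plane → ℂ} (ha : IsTame a) (i : Par) (f : 𝓢(Plane, ℂ))
    (ξ : Plane) : 𝓕 (mulOp a i f) ξ = ∫ η, 𝓕 (a i) (ξ - η) * 𝓕 f η := by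
  have h1 := fourier_mul_eq_integral (ha.smooth i).continuous (UBound.integrable ha i)
    (UBound.integrable_fourier ha i) f.integrable ξ
  rw [← integral_sub_left_eq_self _ _ ξ] at h1
  simp only [sub_sub_cancel] at h1
  have h2 : ⇑(mulOp a i f) = fun x => a i x * f x := funext (mulOp_apply ha i f)
  rw [SchwartzMap.fourier_coe, h2, h1, SchwartzMap.fourier_coe]

lemma fourier_multOp {p : Par → Plane → ℂ} {i : Par} (hp : (p i).HasTemperateGrowth)
    (f : 𝓢(Plane, ℂ)) (ξ : Plane) : 𝓕 (multOp p i f) ξ = p i ξ * 𝓕 f ξ := by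
  have : multOp p i f = 𝓕⁻ (SchwartzMap.smulLeftCLM ℂ (p i) (𝓕 f)) :=
    SchwartzMap.fourierMultiplierCLM_apply _ _
  rw [this, FourierTransform.fourier_fourierInv_eq, SchwartzMap.smulLeftCLM_apply_apply hp,
    smul_eq_mul]

lemma sobNorm_mulOp_le {a : Par → Plane → ℂ} (ha : IsTame a) (s : ℝ) :
    ∃ C : ℝ, 0 ≤ C ∧ ∀ (i : Par) (f : 𝓢(Plane, ℂ)),
      sobNorm i.1 s (mulOp a i f) ≤ ENNReal.ofReal C * sobNorm i.1 s f := by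
  obtain ⟨A, hA, hA'⟩ := UBound.fourier_decay ha (|s| + 3)
  obtain ⟨C, hC, h⟩ := sobNorm_le_of_kernel s s
  refine ⟨C * A, by positivity, fun i f => h i.1 i.1.2 f _ (fun ξ η => 𝓕 (a i) (ξ - η)) A hA
    (fourier_mulOp ha i f) fun ξ η => ?_⟩
  rw [sub_self, jbr_zero, mul_one]
  convert hA' i (ξ - η) using 3
  ring

lemma sobNorm_multOp_le {p : Par → Plane → ℂ} (hp : IsSmallSymbol p) (s : ℝ) :
    ∃ C : ℝ, 0 ≤ C ∧ ∀ (i : Par) (f : 𝓢(Plane, ℂ)),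
      sobNorm i.1 (s + 2) (multOp p i f) ≤ ENNReal.ofReal (C * i.1) * sobNorm i.1 s f := by
  obtain ⟨C, hC, h⟩ := hp.bound 0
  refine ⟨C, hC, fun i f => eLpNorm_le_mul_eLpNorm_of_ae_le_mul (.of_forall fun ξ => ?_) 2⟩
  rw [fourier_multOp (hp.temperate i)]
  simp only [norm_mul, Complex.norm_real, Real.norm_of_nonneg (jbr_pos _ _).le]
  have h1 := h i ξ
  rw [norm_iteratedFDeriv_zero] at h1
  have h2 := (jbr_pos (i.1.1 • ξ) (s + 2)).le
  calc jbr (i.1.1 • ξ) (s + 2) * (‖p i ξ‖ * ‖𝓕 f ξ‖)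
      ≤ jbr (i.1.1 • ξ) (s + 2) * ((C * (i.1 * jbr (i.1.1 • ξ) (-2))) * ‖𝓕 f ξ‖) := by gcongr
    _ = C * i.1 * ((jbr (i.1.1 • ξ) (s + 2) * jbr (i.1.1 • ξ) (-2)) * ‖𝓕 f ξ‖) := by ring
    _ = _ := by rw [jbr_mul, add_neg_cancel_right]

lemma norm_clm_le (L : Plane →L[ℝ] ℂ) :
    ‖L‖ ≤ ∑ j : Fin 2, ‖L (EuclideanSpace.single j 1)‖ := by
  refine L.opNorm_le_bound (by positivity) fun v => ?_
  have e : v = ∑ j : Fin 2, v j • EuclideanSpace.single j (1 : ℝ) := by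
    ext k; fin_cases k <;> simp
  conv_lhs => rw [e]
  rw [map_sum, Finset.sum_mul]
  refine (norm_sum_le _ _).trans (Finset.sum_le_sum fun j _ => ?_)
  rw [map_smul, norm_smul, mul_comm]
  gcongr
  exact PiLp.norm_apply_le v j

lemma IsSlowSymbol.norm_sub_le {p : Par → Plane → ℂ} (hp : IsSlowSymbol p) :
    ∃ C : ℝ, 0 ≤ C ∧ ∀ (i : Par) (ξ η : Plane),
      ‖p i ξ - p i η‖ ≤ C * i.1 * jbr (i.1.1 • η) (-2) * jbr (ξ - η) 3 := by
  choose B hB h using fun m => (hp.2 m).bound 0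
  set C := ∑ j : Fin 2, B (EuclideanSpace.single j 1)
  have hC : 0 ≤ C := Finset.sum_nonneg fun j _ => hB _
  have h1 : ∀ (i : Par) z, ‖fderiv ℝ (p i) z‖ ≤ C * i.1 * jbr (i.1.1 • z) (-2) := by
    intro i z
    refine (norm_clm_le _).trans ?_
    rw [mul_assoc, Finset.sum_mul]
    exact Finset.sum_le_sum fun j _ => by simpa using h (EuclideanSpace.single j 1) i z
  refine ⟨2 * C, by positivity, fun i ξ η => ?_⟩
  have hi := i.1.2.1.le
  have h2 : ∀ z ∈ segment ℝ η ξ,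
      ‖fderiv ℝ (p i) z‖ ≤ C * i.1 * (2 * jbr (i.1.1 • η) (-2) * jbr (ξ - η) 2) := by
    intro z hz
    refine (h1 i z).trans ?_
    have h3 := jbr_smul_peetre i.1.2 z η (-2)
    have h4 : ‖z - η‖ ≤ ‖ξ - η‖ := by
      rw [segment_eq_image'] at hz
      obtain ⟨θ, hθ, rfl⟩ := hz
      rw [add_sub_cancel_left, norm_smul, Real.norm_of_nonneg hθ.1]
      exact mul_le_of_le_one_left (norm_nonneg _) hθ.2
    norm_num at h3
    have := (jbr_pos (i.1.1 • η) (-2)).le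
    exact mul_le_mul_of_nonneg_left (h3.trans (mul_le_mul_of_nonneg_left
      (jbr_le_of_norm_le h4 (by norm_num)) (by positivity))) (by positivity)
  have h5 := Convex.norm_image_sub_le_of_norm_fderiv_le
    (fun z _ => (hp.1 i).1.differentiable (by simp) z) h2 (convex_segment η ξ)
    (left_mem_segment ℝ η ξ) (right_mem_segment ℝ η ξ)
  refine h5.trans ?_
  have h6 := norm_le_jbr (ξ - η)
  have := (jbr_pos (i.1.1 • η) (-2)).le
  have := (jbr_pos (ξ - η) 2).le
  calc _ ≤ C * i.1 * (2 * jbr (i.1.1 • η) (-2) * jbr (ξ - η) 2) * jbr (ξ - η) 1 := by gcongr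
    _ = 2 * C * i.1 * jbr (i.1.1 • η) (-2) * (jbr (ξ - η) 2 * jbr (ξ - η) 1) := by ring
    _ = _ := by rw [jbr_mul]; norm_num

lemma integrable_fourier_mul {a : Par → Plane → ℂ} (ha : IsTame a) (i : Par) (f : 𝓢(Plane, ℂ))
    (ξ : Plane) : Integrable fun η => 𝓕 (a i) (ξ - η) * 𝓕 f η := by
  obtain ⟨A, hA, h⟩ := UBound.fourier_decay ha 0
  refine (𝓕 f).integrable.bdd_mul (c := A) ?_ ?_
  · exact ((continuous_fourier_of_integrable (UBound.integrable ha i)).comp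
      (continuous_const.sub continuous_id)).aestronglyMeasurable
  · exact .of_forall fun η => by simpa [jbr_zero] using h i (ξ - η)

lemma fourier_sub_schwartz (f g : 𝓢(Plane, ℂ)) : 𝓕 (f - g) = 𝓕 f - 𝓕 g :=
  map_sub (FourierTransform.fourierCLM ℂ 𝓢(Plane, ℂ)) f g

lemma sobNorm_commutator_le {p β : Par → Plane → ℂ} (hp : IsSlowSymbol p) (hβ : IsTame β) (s : ℝ) :
    ∃ C : ℝ, 0 ≤ C ∧ ∀ (i : Par) (f : 𝓢(Plane, ℂ)),
      sobNorm i.1 (s + 2) ((multOp p * mulOp β - mulOp β * multOp p) i f)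
        ≤ ENNReal.ofReal (C * i.1) * sobNorm i.1 s f := by
  obtain ⟨A, hA, hA'⟩ := UBound.fourier_decay hβ (|s + 2| + 6)
  obtain ⟨B, hB, hB'⟩ := hp.norm_sub_le
  obtain ⟨C, hC, h⟩ := sobNorm_le_of_kernel s (s + 2)
  refine ⟨C * (A * B), by positivity, fun i f => ?_⟩
  have hi := i.1.2.1.le
  refine (h i.1 i.1.2 f _ (fun ξ η => (p i ξ - p i η) * 𝓕 (β i) (ξ - η)) (A * B * i.1)
    (by positivity) (fun ξ => ?_) fun ξ η => ?_).trans_eq ?_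
  · have e : (multOp p * mulOp β - mulOp β * multOp p) i f
        = multOp p i (mulOp β i f) - mulOp β i (multOp p i f) := rfl
    rw [e, fourier_sub_schwartz, sub_apply, fourier_multOp (hp.1 i), fourier_mulOp hβ,
      fourier_mulOp hβ, ← integral_const_mul, ← integral_sub
        ((integrable_fourier_mul hβ i f ξ).const_mul _)
        (integrable_fourier_mul hβ i (multOp p i f) ξ)]
    congr 1; ext1 η
    rw [fourier_multOp (hp.1 i)]
    ring
  · have h1 := hA' i (ξ - η)
    have h2 := hB' i ξ η
    have := (jbr_pos (i.1.1 • η) (-2)).le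
    have := (jbr_pos (ξ - η) 3).le
    rw [norm_mul]
    calc _ ≤ (B * i.1 * jbr (i.1.1 • η) (-2) * jbr (ξ - η) 3) *
          (A * jbr (ξ - η) (-(|s + 2| + 6))) := by gcongr
      _ = A * B * i.1 * jbr (i.1.1 • η) (-2) *
          (jbr (ξ - η) 3 * jbr (ξ - η) (-(|s + 2| + 6))) := by ring
      _ = _ := by rw [jbr_mul]; ring_nf
  · congr 2; ring

lemma sobNorm_add_le (h s : ℝ) (f g : 𝓢(Plane, ℂ)) :
    sobNorm h s (f + g) ≤ sobNorm h s f + sobNorm h s g := by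
  have hm : ∀ f : 𝓢(Plane, ℂ), AEStronglyMeasurable (fun ξ => (jbr (h • ξ) s : ℂ) * 𝓕 f ξ) :=
    fun f => (((measurable_jbr_smul h s).complex_ofReal).mul
      (𝓕 f).continuous.measurable).aestronglyMeasurable
  refine le_trans (le_of_eq ?_) (eLpNorm_add_le (hm f) (hm g) (by norm_num))
  unfold sobNorm
  congr 1; ext1 ξ
  simp [FourierTransform.fourier_add, mul_add]

lemma sobNorm_smul (h s : ℝ) (c : ℂ) (f : 𝓢(Plane, ℂ)) :
    sobNorm h s (c • f) = ‖c‖ₑ * sobNorm h s f := by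
  unfold sobNorm
  rw [← eLpNorm_const_smul]
  congr 1; ext1 ξ
  simp [FourierTransform.fourier_smul]; ring

lemma sobNorm_zero (h s : ℝ) : sobNorm h s 0 = 0 := by
  simpa using sobNorm_smul h s 0 0

/-- Gaining operators gain a factor `h` and two derivatives. -/
lemma sobNorm_le_of_mem_gaining {T : OpFam} (hT : T ∈ gaining) (s : ℝ) :
    ∃ C : ℝ, 0 ≤ C ∧ ∀ (i : Par) (f : 𝓢(Plane, ℂ)),
      sobNorm i.1 (s + 2) (T i f) ≤ ENNReal.ofReal (C * i.1) * sobNorm i.1 s f := by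
  have comp : ∀ {S : OpFam} {a : Par → Plane → ℂ}, IsRapid a →
      (∃ C : ℝ, 0 ≤ C ∧ ∀ (i : Par) (f : 𝓢(Plane, ℂ)),
        sobNorm i.1 (s + 2) (S i f) ≤ ENNReal.ofReal (C * i.1) * sobNorm i.1 s f) →
      ∃ C : ℝ, 0 ≤ C ∧ ∀ (i : Par) (f : 𝓢(Plane, ℂ)),
        sobNorm i.1 (s + 2) ((S * mulOp a) i f) ≤ ENNReal.ofReal (C * i.1) * sobNorm i.1 s f := by
    rintro S a ha ⟨C, hC, h⟩
    obtain ⟨A, hA, hA'⟩ := sobNorm_mulOp_le ha.isTame s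
    refine ⟨C * A, by positivity, fun i f => ?_⟩
    have hi := i.1.2.1.le
    calc _ ≤ _ := h i (mulOp a i f)
      _ ≤ ENNReal.ofReal (C * i.1) * (ENNReal.ofReal A * sobNorm i.1 s f) := by
        gcongr; exact hA' i f
      _ = _ := by
        rw [← mul_assoc, ← ENNReal.ofReal_mul (by positivity)]
        congr 2; ring
  induction hT using Submodule.span_induction with
  | zero => exact ⟨0, le_rfl, fun i f => by simp [sobNorm_zero]⟩
  | add S T _ _ hS hT =>
    obtain ⟨A, hA, hA'⟩ := hS
    obtain ⟨B, hB, hB'⟩ := hT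
    refine ⟨A + B, by positivity, fun i f => ?_⟩
    have hi := i.1.2.1.le
    rw [add_mul, ENNReal.ofReal_add (by positivity) (by positivity), add_mul]
    exact (sobNorm_add_le _ _ (S i f) (T i f)).trans (add_le_add (hA' i f) (hB' i f))
  | smul c T _ hT =>
    obtain ⟨A, hA, hA'⟩ := hT
    refine ⟨‖c‖ * A, by positivity, fun i f => ?_⟩
    have e : (c • T) i f = c • T i f := rfl
    rw [e, sobNorm_smul, mul_assoc, ENNReal.ofReal_mul (norm_nonneg _), ofReal_norm, mul_assoc]
    gcongr
    exact hA' i f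
  | mem T hT =>
    rcases hT with ⟨p, a, hp, ha, rfl⟩ | ⟨p, β, a, hp, hβ, ha, rfl⟩
    · exact comp ha (sobNorm_multOp_le hp s)
    · exact comp ha (sobNorm_commutator_le hp hβ s)

/-- Plancherel's theorem on `L¹ ∩ L²`. -/
lemma eLpNorm_fourier_eq {G : Plane → ℂ} (h1 : Integrable G) (h2 : MemLp G 2) :
    eLpNorm (𝓕 G) 2 = eLpNorm G 2 := by
  set L : Lp ℂ 2 (volume : Measure Plane) := h2.toLp G with hL
  have hae : 𝓕 G =ᵐ[volume] (𝓕 L : Lp ℂ 2 (volume : Measure Plane)) := by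
    refine ae_eq_of_integral_contDiff_smul_eq
      (continuous_fourier_of_integrable h1).locallyIntegrable
      ((Lp.memLp _).locallyIntegrable (by norm_num)) fun g hg hgs => ?_
    have hgs' : HasCompactSupport fun x => (g x : ℂ) := hgs.comp_left Complex.ofReal_zero
    set χ : 𝓢(Plane, ℂ) := HasCompactSupport.toSchwartzMap hgs' (Complex.ofRealCLM.contDiff.comp hg)
    have hχ : ∀ x, χ x = g x := fun x => rfl
    have e1 : ∫ x, g x • (𝓕 L : Lp ℂ 2 (volume : Measure Plane)) x = ∫ x, (𝓕 χ) x • L x := by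
      have h3 := congrArg (fun T : 𝓢'(Plane, ℂ) => T χ) (Lp.fourier_toTemperedDistribution_eq L)
      simp only [TemperedDistribution.fourier_apply, Lp.toTemperedDistribution_apply] at h3
      rw [h3]
      rfl
    rw [e1]
    have e2 : ∫ x, (𝓕 χ) x • L x = ∫ x, (𝓕 χ) x • G x :=
      integral_congr_ae (h2.coeFn_toLp.mono fun x hx => by simp only [hL]; rw [hx])
    rw [e2]
    have e3 := VectorFourier.integral_fourierIntegral_smul_eq_flip (L := innerₗ Plane)
          Real.continuous_fourierChar (by exact continuous_inner) (χ.integrable (μ := volume)) h1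
    rw [flip_innerₗ] at e3
    exact e3.symm
  rw [eLpNorm_congr_ae hae, ← Lp.enorm_def, ← eLpNorm_congr_ae h2.coeFn_toLp, ← Lp.enorm_def,
    ← ofReal_norm, ← ofReal_norm, Lp.norm_fourier_eq]

lemma fourier_translate (A : Plane → ℂ) (k ζ : Plane) :
    𝓕 (fun x => A (x - k)) ζ = Real.fourierChar (-inner ℝ k ζ) • 𝓕 A ζ := by
  rw [Real.fourier_eq, Real.fourier_eq, ← integral_add_right_eq_self _ k,
    Circle.smul_def, ← integral_smul]
  congr 1; ext1 x
  rw [← Circle.smul_def, smul_smul, ← AddChar.map_add_eq_mul, add_sub_cancel_right, inner_add_left]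
  congr 3; ring

lemma sobNorm_sq (h s : ℝ) (f : 𝓢(Plane, ℂ)) :
    sobNorm h s f ^ 2 = ∫⁻ ξ, ENNReal.ofReal (jbr (h • ξ) s) ^ 2 * ‖𝓕 f ξ‖ₑ ^ 2 := by
  rw [sobNorm, eLpNorm_two_sq]
  congr 1; ext1 ξ
  rw [enorm_mul, mul_pow, ← ofReal_norm, Complex.norm_real, Real.norm_of_nonneg (jbr_pos _ _).le]

/-- Translates of a window form a bounded frame of every semiclassical Sobolev space. -/
lemma lintegral_sobNorm_window {a : Par → Plane → ℂ} (ha : IsTame a) {A : Plane → ℂ}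
    (haA : ∀ i x, a i x = A (x - i.2)) (s : ℝ) :
    ∃ C : ℝ, 0 ≤ C ∧ ∀ (h : Set.Ioo (0 : ℝ) 1) (f : 𝓢(Plane, ℂ)),
      Measurable (fun k => sobNorm h s (mulOp a (h, k) f)) ∧
      ∫⁻ k, sobNorm h s (mulOp a (h, k) f) ^ 2 ≤ ENNReal.ofReal C * sobNorm h s f ^ 2 := by
  obtain ⟨B, hB, hdec⟩ := UBound.fourier_decay ha (|s| + 3)
  set I := ∫ ζ : Plane, jbr ζ (-3)
  have hI : 0 ≤ I := integral_nonneg fun ζ => (jbr_pos _ _).le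
  refine ⟨(2 ^ (|s| / 2) * B) ^ 2 * I, by positivity, fun h f => ?_⟩
  have hA0 : a (h, 0) = A := funext fun x => by simp [haA]
  have hAdec : ∀ ζ, ‖𝓕 A ζ‖ ≤ B * jbr ζ (-(|s| + 3)) := fun ζ => by
    simpa [hA0] using hdec (h, 0) ζ
  have hAc : Continuous (𝓕 A) := by
    rw [← hA0]; exact continuous_fourier_of_integrable (UBound.integrable ha (h, 0))
  have hfc : Continuous ⇑(𝓕 f : 𝓢(Plane, ℂ)) := (𝓕 f).continuous
  obtain ⟨G, hG⟩ : ∃ G : Plane → Plane → ℂ, ∀ ξ η, G ξ η = 𝓕 A (ξ - η) * 𝓕 f η := ⟨_, fun _ _ => rfl⟩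
  have hGc : Continuous fun z : Plane × Plane => G z.1 z.2 := by
    simp only [hG]
    exact (hAc.comp (continuous_fst.sub continuous_snd)).mul (hfc.comp continuous_snd)
  have hG1 : ∀ ξ, Integrable (G ξ) := fun ξ => by
    rw [show G ξ = _ from funext (hG ξ)]
    simpa [hA0] using integrable_fourier_mul ha (h, 0) f ξ
  have hG2 : ∀ ξ, MemLp (G ξ) 2 := fun ξ => by
    refine MemLp.of_le_mul (c := B) ((𝓕 f).memLp 2) (hG1 ξ).aestronglyMeasurable
      (.of_forall fun η => ?_)
    rw [hG, norm_mul]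
    refine mul_le_mul_of_nonneg_right ((hAdec _).trans ?_) (norm_nonneg _)
    exact mul_le_of_le_one_right hB (jbr_le_one _ (by have := abs_nonneg s; linarith))
  have hker : ∀ k ξ, ‖𝓕 (mulOp a (h, k) f) ξ‖ₑ = ‖𝓕 (G ξ) (-k)‖ₑ := by
    intro k ξ
    have h1 : 𝓕 (mulOp a (h, k) f) ξ
        = Real.fourierChar (-inner ℝ k ξ) • 𝓕 (G ξ) (-k) := by
      rw [fourier_mulOp ha, Real.fourier_eq, Circle.smul_def, ← integral_smul]
      congr 1; ext1 η
      have : a (h, k) = fun x => A (x - k) := funext fun x => haA _ x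
      rw [this, fourier_translate, ← Circle.smul_def, smul_smul, ← AddChar.map_add_eq_mul, hG,
        smul_mul_assoc]
      congr 2
      rw [inner_sub_right, inner_neg_right, real_inner_comm k η]; ring
    rw [h1, ← ofReal_norm, ← ofReal_norm, Circle.norm_smul]
  have hmeas : Measurable fun z : Plane × Plane =>
      ENNReal.ofReal (jbr (h.1 • z.2) s) ^ 2 * ‖𝓕 (mulOp a (h, z.1) f) z.2‖ₑ ^ 2 := by
    have h1 : StronglyMeasurable fun z : Plane × Plane => 𝓕 (G z.2) (-z.1) := by
      simp only [Real.fourier_eq]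
      refine StronglyMeasurable.integral_prod_right
        (f := fun (z : Plane × Plane) v => Real.fourierChar (-inner ℝ v (-z.1)) • G z.2 v) ?_
      refine Continuous.stronglyMeasurable ?_
      refine (Real.continuous_fourierChar.comp ?_).smul ?_
      · exact (continuous_snd.inner continuous_fst.fst.neg).neg
      · exact hGc.comp (continuous_fst.snd.prodMk continuous_snd)
    simp only [hker]
    exact (((measurable_jbr_smul h.1 s).comp measurable_snd).ennreal_ofReal.pow_const 2).mul
      (h1.measurable.enorm.pow_const 2)
  constructor
  · have h2 : Measurable fun k => sobNorm h s (mulOp a (h, k) f) ^ 2 := by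
      simp only [sobNorm_sq]
      exact Measurable.lintegral_prod_right' hmeas
    have h3 : ∀ x : ℝ≥0∞, (x ^ 2) ^ (1 / 2 : ℝ) = x := fun x => by
      rw [← ENNReal.rpow_natCast, ← ENNReal.rpow_mul]; simp
    simpa only [h3] using h2.pow_const (1 / 2 : ℝ)
  simp only [sobNorm_sq]
  calc _ = ∫⁻ ξ, ∫⁻ k, ENNReal.ofReal (jbr (h.1 • ξ) s) ^ 2 * ‖𝓕 (mulOp a (h, k) f) ξ‖ₑ ^ 2 :=
        lintegral_lintegral_swap (f := fun k ξ =>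
          ENNReal.ofReal (jbr (h.1 • ξ) s) ^ 2 * ‖𝓕 (mulOp a (h, k) f) ξ‖ₑ ^ 2) hmeas.aemeasurable
    _ = ∫⁻ ξ, ∫⁻ η, ENNReal.ofReal (jbr (h.1 • ξ) s) ^ 2 * ‖G ξ η‖ₑ ^ 2 := by
        congr 1; ext1 ξ
        simp only [hker]
        have hm1 : Measurable (𝓕 (G ξ)) := (continuous_fourier_of_integrable (hG1 ξ)).measurable
        have hm1' : Measurable fun k => 𝓕 (G ξ) (-k) := hm1.comp measurable_neg
        have hm2 : Measurable (G ξ) := (hGc.comp (Continuous.prodMk_right ξ)).measurable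
        rw [lintegral_const_mul _ (hm2.enorm.pow_const 2), lintegral_const_mul _
          (hm1'.enorm.pow_const 2),
          lintegral_neg_eq_self (fun k => ‖𝓕 (G ξ) k‖ₑ ^ 2), ← eLpNorm_two_sq, ← eLpNorm_two_sq,
          eLpNorm_fourier_eq (hG1 ξ) (hG2 ξ)]
    _ ≤ ∫⁻ ξ, ∫⁻ η, ENNReal.ofReal ((2 ^ (|s| / 2) * B) ^ 2 * jbr (ξ - η) (-3)) *
          (ENNReal.ofReal (jbr (h.1 • η) s) ^ 2 * ‖𝓕 f η‖ₑ ^ 2) := by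
        refine lintegral_mono fun ξ => lintegral_mono fun η => ?_
        simp only [hG]
        rw [enorm_mul, mul_pow, ← mul_assoc, ← mul_assoc]
        refine mul_le_mul_left ?_ _
        rw [← ofReal_norm, ← ENNReal.ofReal_pow (jbr_pos _ _).le,
          ← ENNReal.ofReal_pow (jbr_pos _ _).le, ← ENNReal.ofReal_pow (norm_nonneg _),
          ← ENNReal.ofReal_mul (by positivity), ← ENNReal.ofReal_mul
            (mul_nonneg (by positivity) (jbr_pos _ _).le)]
        refine ENNReal.ofReal_le_ofReal ?_
        have p1 := (jbr_pos (h.1 • η) s).le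
        have p2 := jbr_pos (ξ - η) |s|
        have p3 := jbr_pos (ξ - η) (-3)
        have p4 := jbr_pos (ξ - η) (-(|s| + 3))
        have h1 : jbr (h.1 • ξ) s * ‖𝓕 A (ξ - η)‖
            ≤ (2 ^ (|s| / 2) * B) * jbr (h.1 • η) s * jbr (ξ - η) (-3) := by
          calc _ ≤ (2 ^ (|s| / 2) * jbr (h.1 • η) s * jbr (ξ - η) |s|) *
                (B * jbr (ξ - η) (-(|s| + 3))) :=
                mul_le_mul (jbr_smul_peetre h.2 ξ η s) (hAdec _) (norm_nonneg _) (by positivity)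
            _ = (2 ^ (|s| / 2) * B) * jbr (h.1 • η) s *
                (jbr (ξ - η) |s| * jbr (ξ - η) (-(|s| + 3))) := by ring
            _ = _ := by rw [jbr_mul, show |s| + -(|s| + 3) = -3 by ring]
        have h2 : jbr (ξ - η) (-3) ^ 2 ≤ jbr (ξ - η) (-3) := by
          have := jbr_le_one (ξ - η) (t := -3) (by norm_num)
          nlinarith
        calc _ = (jbr (h.1 • ξ) s * ‖𝓕 A (ξ - η)‖) ^ 2 := by ring
          _ ≤ ((2 ^ (|s| / 2) * B) * jbr (h.1 • η) s * jbr (ξ - η) (-3)) ^ 2 :=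
              pow_le_pow_left₀ (mul_nonneg (jbr_pos _ _).le (norm_nonneg _)) h1 2
          _ = (2 ^ (|s| / 2) * B) ^ 2 * jbr (h.1 • η) s ^ 2 * jbr (ξ - η) (-3) ^ 2 := by ring
          _ ≤ (2 ^ (|s| / 2) * B) ^ 2 * jbr (h.1 • η) s ^ 2 * jbr (ξ - η) (-3) := by gcongr
          _ = _ := by ring
    _ = ∫⁻ η, ∫⁻ ξ, ENNReal.ofReal ((2 ^ (|s| / 2) * B) ^ 2 * jbr (ξ - η) (-3)) *
          (ENNReal.ofReal (jbr (h.1 • η) s) ^ 2 * ‖𝓕 f η‖ₑ ^ 2) := by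
        refine lintegral_lintegral_swap (Measurable.aemeasurable ?_)
        refine Measurable.fun_mul ?_ (Measurable.fun_mul ?_ ?_)
        · exact (((continuous_jbr (-3)).measurable.comp (measurable_fst.sub measurable_snd)).const_mul
            _).ennreal_ofReal
        · exact ((measurable_jbr_smul h.1 s).comp measurable_snd).ennreal_ofReal.pow_const 2
        · exact (hfc.measurable.comp measurable_snd).enorm.pow_const 2
    _ = _ := by
        have hm : Measurable fun ζ : Plane =>
            ENNReal.ofReal ((2 ^ (|s| / 2) * B) ^ 2 * jbr ζ (-3)) :=
          ((continuous_jbr (-3)).measurable.const_mul _).ennreal_ofReal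
        rw [← lintegral_const_mul']
        · congr 1; ext1 η
          have hm' : Measurable fun ξ : Plane =>
              ENNReal.ofReal ((2 ^ (|s| / 2) * B) ^ 2 * jbr (ξ - η) (-3)) :=
            hm.comp (measurable_id.sub_const η)
          rw [lintegral_mul_const _ hm',
            lintegral_sub_right_eq_self
              (fun ζ => ENNReal.ofReal ((2 ^ (|s| / 2) * B) ^ 2 * jbr ζ (-3))) η,
            ← ofReal_integral_eq_lintegral_ofReal (integrable_jbr_neg_three.const_mul _)
              (.of_forall fun ζ => mul_nonneg (by positivity) (jbr_pos _ _).le),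
            integral_const_mul]
        · exact ENNReal.ofReal_ne_top

/-- The symbol of `⟨hD⟩⁻¹`. -/
noncomputable def bracketSymbol (i : Par) (x : Plane) : ℂ := (jbr (i.1.1 • x) (-1) : ℂ)

lemma norm_iteratedFDeriv_bracketSymbol_le (n : ℕ) : ∃ C : ℝ, 0 ≤ C ∧ ∀ (i : Par) (x : Plane),
    ‖iteratedFDeriv ℝ n (bracketSymbol i) x‖ ≤ C * (i.1.1 ^ n * jbr (i.1.1 • x) (-1 - n)) := by
  obtain ⟨C, hC, h⟩ := norm_iteratedFDeriv_jbr_le n (-1)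
  refine ⟨C, hC, fun i x => ?_⟩
  have hs : ContDiff ℝ ∞ (fun x : Plane => jbr (i.1.1 • x) (-1)) :=
    (jbr_contDiff (-1)).comp (contDiff_const_smul _)
  have e := iteratedFDeriv_comp_const_smul (𝕜 := ℝ) i.1.1
    ((jbr_contDiff (-1)).of_le (m := n) (by exact_mod_cast le_top))
  rw [show bracketSymbol i = fun x => ((jbr (i.1.1 • x) (-1) : ℝ) : ℂ) from rfl,
    norm_iteratedFDeriv_ofReal hs, e, norm_smul, norm_pow, Real.norm_of_nonneg i.1.2.1.le]
  have := pow_nonneg i.1.2.1.le n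
  calc _ ≤ i.1.1 ^ n * (C * jbr (i.1.1 • x) (-1 - n)) := by gcongr; exact h _
    _ = _ := by ring

lemma contDiff_bracketSymbol (i : Par) : ContDiff ℝ ∞ (bracketSymbol i) :=
  Complex.ofRealCLM.contDiff.comp ((jbr_contDiff (-1)).comp (contDiff_const_smul i.1.1))

lemma isSlowSymbol_bracketSymbol : IsSlowSymbol bracketSymbol := by
  refine ⟨fun i => ⟨contDiff_bracketSymbol i, fun n => ?_⟩, fun m => ?_⟩
  · obtain ⟨C, hC, h⟩ := norm_iteratedFDeriv_bracketSymbol_le n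
    refine ⟨0, C, fun x => (h i x).trans ?_⟩
    have h1 := jbr_le_one (i.1.1 • x) (t := -1 - n) (by linarith [Nat.cast_nonneg (α := ℝ) n])
    have h2 := pow_le_one₀ (n := n) i.1.2.1.le i.1.2.2.le
    rw [pow_zero, mul_one]
    exact mul_le_of_le_one_right hC (mul_le_one₀ h2 (jbr_pos _ _).le h1)
  · have hs : ∀ i, ContDiff ℝ ∞ (fderiv ℝ (bracketSymbol i)) := fun i =>
      (contDiff_bracketSymbol i).fderiv_right (by simp)
    refine ⟨fun i => (hs i).clm_apply contDiff_const, fun n => ?_⟩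
    obtain ⟨C, hC, h⟩ := norm_iteratedFDeriv_bracketSymbol_le (n + 1)
    refine ⟨‖m‖ * C, by positivity, fun i x => ?_⟩
    refine (norm_iteratedFDeriv_clm_apply_const (hs i).contDiffAt
      (by exact_mod_cast le_top)).trans ?_
    rw [norm_iteratedFDeriv_fderiv, mul_assoc]
    refine mul_le_mul_of_nonneg_left ((h i x).trans ?_) (norm_nonneg _)
    have h1 : jbr (i.1.1 • x) (-1 - (n + 1 : ℕ)) ≤ jbr (i.1.1 • x) (-2) :=
      jbr_mono _ (by push_cast; linarith [Nat.cast_nonneg (α := ℝ) n])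
    have h2 : i.1.1 ^ (n + 1) ≤ i.1.1 := by
      rw [pow_succ]
      exact mul_le_of_le_one_left i.1.2.1.le (pow_le_one₀ i.1.2.1.le i.1.2.2.le)
    exact mul_le_mul_of_nonneg_left (mul_le_mul h2 h1 (jbr_pos _ _).le i.1.2.1.le) hC

section Coefficient
variable {κ : ℝ} {b : Plane → ℝ}

lemma coefficient_temperate (hκ : 0 ≤ κ) (hb : ContDiff ℝ ∞ b)
    (hd : ∀ n : ℕ, ∃ C : ℝ, ∀ y : Plane, ‖iteratedFDeriv ℝ n b y‖ ≤ C * jbr y (-κ - n)) :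
    (fun x => (b x : ℂ)).HasTemperateGrowth := by
  refine ⟨Complex.ofRealCLM.contDiff.comp hb, fun n => ?_⟩
  obtain ⟨C, h⟩ := hd n
  refine ⟨0, |C|, fun x => ?_⟩
  rw [norm_iteratedFDeriv_ofReal hb, pow_zero, mul_one]
  refine (h x).trans ?_
  have h1 := jbr_le_one x (t := -κ - n) (by linarith [Nat.cast_nonneg (α := ℝ) n])
  have h2 := (jbr_pos x (-κ - n)).le
  calc _ ≤ |C| * jbr x (-κ - n) := by gcongr; exact le_abs_self C
    _ ≤ |C| := mul_le_of_le_one_right (abs_nonneg C) h1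

lemma uBound_coefficient_sub (hκ : 0 ≤ κ) (hb : ContDiff ℝ ∞ b)
    (hd : ∀ n : ℕ, ∃ C : ℝ, ∀ y : Plane, ‖iteratedFDeriv ℝ n b y‖ ≤ C * jbr y (-κ - n)) :
    UBound (fun (i : Par) x => jbr (x - i.2) (κ + 2))
      (fun i x => ((jbr i.2 (κ + 1) * (b x - b i.2) : ℝ) : ℂ)) := by
  have hs : ∀ i : Par, ContDiff ℝ ∞ (fun x => jbr i.2 (κ + 1) * (b x - b i.2)) := fun i =>
    contDiff_const.mul (hb.sub contDiff_const)
  set c : ℝ := 2 ^ ((κ + 1) / 2)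
  have hc : 0 ≤ c := by positivity
  have hpeetre : ∀ x k : Plane,
      jbr k (κ + 1) * jbr x (-κ - 1) ≤ c * jbr (x - k) (κ + 1) := fun x k => by
    have h1 := jbr_peetre x k (-κ - 1)
    rw [abs_of_nonpos (by linarith), show -(-κ - 1) = κ + 1 by ring] at h1
    calc _ ≤ jbr k (κ + 1) * (c * jbr k (-κ - 1) * jbr (x - k) (κ + 1)) :=
          mul_le_mul_of_nonneg_left h1 (jbr_pos _ _).le
      _ = c * jbr (x - k) (κ + 1) * (jbr k (κ + 1) * jbr k (-κ - 1)) := by ring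
      _ = _ := by rw [jbr_mul, show κ + 1 + (-κ - 1) = 0 by ring, jbr_zero, mul_one]
  refine ⟨fun i => Complex.ofRealCLM.contDiff.comp (hs i), fun n => ?_⟩
  rcases n with _ | n
  · obtain ⟨C, h⟩ := hd 1
    refine ⟨|C| * c, by positivity, fun i x => ?_⟩
    have h1 : ∀ z ∈ Metric.closedBall i.2 ‖x - i.2‖,
        ‖fderiv ℝ b z‖ ≤ |C| * c * jbr i.2 (-κ - 1) * jbr (x - i.2) (κ + 1) := by
      intro z hz
      rw [mem_closedBall_iff_norm] at hz
      rw [← norm_iteratedFDeriv_one]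
      have h2 := hpeetre z i.2
      have h3 : jbr (z - i.2) (κ + 1) ≤ jbr (x - i.2) (κ + 1) :=
        jbr_le_of_norm_le hz (by linarith)
      have p1 := (jbr_pos z (-κ - 1)).le
      have p2 := (jbr_pos i.2 (-κ - 1)).le
      calc _ ≤ C * jbr z (-κ - 1) := by simpa using h z
        _ ≤ |C| * jbr z (-κ - 1) := by gcongr; exact le_abs_self C
        _ = |C| * (jbr i.2 (-κ - 1) * (jbr i.2 (κ + 1) * jbr z (-κ - 1))) := by
          rw [← mul_assoc (jbr i.2 _), jbr_mul, show -κ - 1 + (κ + 1) = 0 by ring, jbr_zero,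
            one_mul]
        _ ≤ |C| * (jbr i.2 (-κ - 1) * (c * jbr (x - i.2) (κ + 1))) := by
          exact mul_le_mul_of_nonneg_left (mul_le_mul_of_nonneg_left
            (h2.trans (mul_le_mul_of_nonneg_left h3 hc)) p2) (abs_nonneg C)
        _ = _ := by ring
    have h4 := (convex_closedBall i.2 ‖x - i.2‖).norm_image_sub_le_of_norm_fderiv_le
      (fun z _ => hb.differentiable (by simp) z) h1
      (Metric.mem_closedBall_self (norm_nonneg _)) (mem_closedBall_iff_norm.2 le_rfl)
    rw [norm_iteratedFDeriv_zero, Complex.norm_real, norm_mul, Real.norm_of_nonneg (jbr_pos _ _).le]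
    have p1 := (jbr_pos i.2 (κ + 1)).le
    have p2 := (jbr_pos i.2 (-κ - 1)).le
    have p3 := (jbr_pos (x - i.2) (κ + 1)).le
    calc _ ≤ jbr i.2 (κ + 1) * (|C| * c * jbr i.2 (-κ - 1) * jbr (x - i.2) (κ + 1)
          * jbr (x - i.2) 1) := by
          refine mul_le_mul_of_nonneg_left (h4.trans ?_) p1
          gcongr
          exact norm_le_jbr _
      _ = |C| * c * (jbr i.2 (κ + 1) * jbr i.2 (-κ - 1)) *
          (jbr (x - i.2) (κ + 1) * jbr (x - i.2) 1) := by ring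
      _ = _ := by
        rw [jbr_mul, jbr_mul, show κ + 1 + (-κ - 1) = 0 by ring, jbr_zero, mul_one,
          show κ + 1 + 1 = κ + 2 by ring]
  · obtain ⟨C, h⟩ := hd (n + 1)
    refine ⟨|C| * c, by positivity, fun i x => ?_⟩
    rw [norm_iteratedFDeriv_ofReal (hs i)]
    have e : iteratedFDeriv ℝ (n + 1) (fun x => jbr i.2 (κ + 1) * (b x - b i.2)) x
        = jbr i.2 (κ + 1) • iteratedFDeriv ℝ (n + 1) b x := by
      have hbn : ContDiffAt ℝ (n + 1 : ℕ) b x := hb.contDiffAt.of_le (by exact_mod_cast le_top)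
      have := iteratedFDeriv_const_smul_apply (a := jbr i.2 (κ + 1))
        (hbn.sub (contDiffAt_const (c := b i.2)))
      refine this.trans ?_
      congr 1
      have h2 := iteratedFDeriv_sub_apply hbn (contDiffAt_const (c := b i.2))
      refine h2.trans ?_
      rw [iteratedFDeriv_succ_const]
      simp
    rw [e, norm_smul, Real.norm_of_nonneg (jbr_pos _ _).le]
    have p0 := (jbr_pos i.2 (κ + 1)).le
    have p1 := (jbr_pos x (-κ - (n + 1 : ℕ))).le
    have h5 : jbr x (-κ - (n + 1 : ℕ)) ≤ jbr x (-κ - 1) :=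
      jbr_mono _ (by push_cast; linarith [Nat.cast_nonneg (α := ℝ) n])
    calc _ ≤ jbr i.2 (κ + 1) * (|C| * jbr x (-κ - 1)) := by
          refine mul_le_mul_of_nonneg_left ((h x).trans ?_) p0
          exact mul_le_mul (le_abs_self C) h5 p1 (abs_nonneg C)
      _ = |C| * (jbr i.2 (κ + 1) * jbr x (-κ - 1)) := by ring
      _ ≤ |C| * (c * jbr (x - i.2) (κ + 1)) :=
          mul_le_mul_of_nonneg_left (hpeetre x i.2) (abs_nonneg C)
      _ ≤ |C| * (c * jbr (x - i.2) (κ + 2)) := by gcongr; exact jbr_mono _ (by linarith)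
      _ = _ := by ring

lemma uBound_weight_ratio (t : ℝ) :
    UBound (fun (i : Par) x => jbr (x - i.2) |t|)
      (fun i x => ((jbr i.2 (-t) * jbr x t : ℝ) : ℂ)) := by
  have hs : ∀ i : Par, ContDiff ℝ ∞ (fun x => jbr i.2 (-t) * jbr x t) := fun i =>
    contDiff_const.mul (jbr_contDiff t)
  refine ⟨fun i => Complex.ofRealCLM.contDiff.comp (hs i), fun n => ?_⟩
  obtain ⟨C, hC, h⟩ := norm_iteratedFDeriv_jbr_le n t
  refine ⟨C * 2 ^ (|t| / 2), by positivity, fun i x => ?_⟩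
  have e : iteratedFDeriv ℝ n (fun x => jbr i.2 (-t) * jbr x t) x
      = jbr i.2 (-t) • iteratedFDeriv ℝ n (fun x => jbr x t) x :=
    iteratedFDeriv_const_smul_apply (a := jbr i.2 (-t))
      ((jbr_contDiff t).contDiffAt.of_le (by exact_mod_cast le_top))
  rw [norm_iteratedFDeriv_ofReal (hs i), e, norm_smul, Real.norm_of_nonneg (jbr_pos _ _).le]
  have p0 := (jbr_pos i.2 (-t)).le
  calc _ ≤ jbr i.2 (-t) * (C * (2 ^ (|t| / 2) * jbr i.2 t * jbr (x - i.2) |t|)) := by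
        refine mul_le_mul_of_nonneg_left ((h x).trans (mul_le_mul_of_nonneg_left ?_ hC)) p0
        refine (jbr_mono _ ?_).trans (jbr_peetre x i.2 t)
        linarith [Nat.cast_nonneg (α := ℝ) n]
    _ = C * 2 ^ (|t| / 2) * (jbr i.2 (-t) * jbr i.2 t) * jbr (x - i.2) |t| := by ring
    _ = _ := by rw [jbr_mul, neg_add_cancel, jbr_zero, mul_one]

end Coefficient

/-- Translates of a compactly supported function. -/
lemma isRapid_translate {φ : Plane → ℂ} (hφ : ContDiff ℝ ∞ φ) (hc : HasCompactSupport φ) :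
    IsRapid fun i x => φ (x - i.2) := by
  intro r
  refine ⟨fun i => hφ.comp (contDiff_id.sub contDiff_const), fun n => ?_⟩
  have h1 : Continuous fun y => jbr y r * ‖iteratedFDeriv ℝ n φ y‖ :=
    (continuous_jbr r).mul (hφ.continuous_iteratedFDeriv (by exact_mod_cast le_top)).norm
  have h2 : HasCompactSupport fun y => jbr y r * ‖iteratedFDeriv ℝ n φ y‖ :=
    ((hc.iteratedFDeriv n).norm).mul_left
  obtain ⟨C, hC⟩ := h1.bounded_above_of_compact_support h2
  refine ⟨|C|, abs_nonneg C, fun i x => ?_⟩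
  rw [iteratedFDeriv_comp_sub, jbr_neg, ← div_eq_mul_inv, le_div_iff₀ (jbr_pos _ _), mul_comm]
  exact ((le_abs_self _).trans (hC (x - i.2))).trans (le_abs_self C)

lemma temperate_ofReal {f : Plane → ℝ} (hf : f.HasTemperateGrowth) :
    (fun x => (f x : ℂ)).HasTemperateGrowth :=
  Complex.ofRealCLM.hasTemperateGrowth.comp hf

lemma jbr_smul_temperate (h t : ℝ) : (fun ξ : Plane => (jbr (h • ξ) t : ℂ)).HasTemperateGrowth :=
  temperate_ofReal ((jbr_temperate t).comp
    (h • ContinuousLinearMap.id ℝ Plane).hasTemperateGrowth)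

/-- The operator `⟨hD⟩^s` on Schwartz space. -/
noncomputable def bracketOp (h s : ℝ) : 𝓢(Plane, ℂ) →L[ℂ] 𝓢(Plane, ℂ) :=
  SchwartzMap.fourierMultiplierCLM ℂ fun ξ => (jbr (h • ξ) s : ℂ)

lemma fourier_bracketOp (h s : ℝ) (f : 𝓢(Plane, ℂ)) (ξ : Plane) :
    𝓕 (bracketOp h s f) ξ = (jbr (h • ξ) s : ℂ) * 𝓕 f ξ := by
  rw [bracketOp, SchwartzMap.fourierMultiplierCLM_apply, FourierTransform.fourier_fourierInv_eq,
    SchwartzMap.smulLeftCLM_apply_apply (jbr_smul_temperate h s), smul_eq_mul]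

/-- Multiplication by a real function on Schwartz space. -/
noncomputable def realMulOp (b : Plane → ℝ) : 𝓢(Plane, ℂ) →L[ℂ] 𝓢(Plane, ℂ) :=
  SchwartzMap.smulLeftCLM ℂ fun x => (b x : ℂ)

lemma realMulOp_apply {b : Plane → ℝ} (hb : (fun x => (b x : ℂ)).HasTemperateGrowth)
    (f : 𝓢(Plane, ℂ)) (x : Plane) : realMulOp b f x = (b x : ℂ) * f x :=
  SchwartzMap.smulLeftCLM_apply_apply hb f x

/-- The commutator `[⟨hD⟩⁻¹, b]` on Schwartz space. -/
noncomputable def commOp (b : Plane → ℝ) (h : ℝ) : 𝓢(Plane, ℂ) →L[ℂ] 𝓢(Plane, ℂ) :=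
  bracketOp h (-1) ∘L realMulOp b - realMulOp b ∘L bracketOp h (-1)

lemma commOp_apply (b : Plane → ℝ) (h : ℝ) (f : 𝓢(Plane, ℂ)) :
    commOp b h f = bracketOp h (-1) (realMulOp b f) - realMulOp b (bracketOp h (-1) f) := rfl

/-- Localized commutators are gaining operators, up to a polynomial weight. -/
lemma exists_gaining_localized {κ : ℝ} {b : Plane → ℝ} (hκ : 0 ≤ κ) (hb : ContDiff ℝ ∞ b)
    (hd : ∀ n : ℕ, ∃ C : ℝ, ∀ y : Plane, ‖iteratedFDeriv ℝ n b y‖ ≤ C * jbr y (-κ - n))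
    {φ : Plane → ℂ} (hφ : ContDiff ℝ ∞ φ) (hφc : HasCompactSupport φ)
    {P : ℕ} (hP : κ + 5 ≤ 2 * P) :
    ∃ S ∈ gaining, ∀ (i : Par) (f : 𝓢(Plane, ℂ)) (x : Plane),
      S i f x = (jbr (x - i.2) (2 * P) : ℂ) *
        commOp b i.1 (realMulOp (fun x => jbr x (κ + 1)) (mulOp (fun i x => φ (x - i.2)) i f)) x := by
  have hbt := coefficient_temperate hκ hb hd
  have hwt : (fun x => (jbr x (κ + 1) : ℂ)).HasTemperateGrowth := temperate_ofReal (jbr_temperate _)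
  set q : Par → Plane → ℂ := fun i x => ((jbr i.2 (κ + 1) * (b x - b i.2) : ℝ) : ℂ) with hq
  set β : Par → Plane → ℂ := fun i x => (jbr (x - i.2) (-(2 * P)) : ℂ) * q i x with hβ
  set r : Par → Plane → ℂ := fun i x => ((jbr i.2 (-(κ + 1)) * jbr x (κ + 1) : ℝ) : ℂ) with hr
  set a : Par → Plane → ℂ := fun i x => r i x * φ (x - i.2) with ha
  have hφr := isRapid_translate hφ hφc
  have hβ' : IsTame β := by
    refine ((uBound_jbr (fun i : Par => i.2) (-(2 * P))).mul (uBound_coefficient_sub hκ hb hd)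
      fun i x => (jbr_pos _ _).le).mono zero_le_one fun i x => ?_
    rw [jbr_mul, one_mul]
    exact jbr_mono _ (by linarith)
  have ha' : IsRapid a := by
    intro ρ
    refine ((uBound_weight_ratio (κ + 1)).mul (hφr (ρ + |κ + 1|))
      fun i x => (jbr_pos _ _).le).mono zero_le_one fun i x => ?_
    rw [jbr_mul, one_mul]
    exact jbr_mono _ (by linarith)
  have hβa : IsRapid fun i x => β i x * a i x := by
    intro ρ
    refine (UBound.mul hβ' (ha' ρ) fun i x => (jbr_pos _ _).le).mono zero_le_one fun i x => ?_
    rw [jbr_mul, one_mul]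
    exact jbr_mono _ (by linarith)
  refine ⟨_, weightOp_pow_commutator_mem isSlowSymbol_bracketSymbol hβ' ha' hβa P,
    fun i f x => ?_⟩
  set c : ℂ := (jbr i.2 (κ + 1) : ℂ) with hc
  set c' : ℂ := (jbr i.2 (-(κ + 1)) : ℂ) with hc'
  have hcc : c * c' = 1 := by
    rw [hc, hc', ← Complex.ofReal_mul, jbr_mul, add_neg_cancel, jbr_zero, Complex.ofReal_one]
  have e1 : ∀ g : 𝓢(Plane, ℂ), (weightOp ^ P * mulOp β) i g
      = c • (realMulOp b g - (b i.2 : ℂ) • g) := by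
    intro g; ext y
    change (weightOp ^ P) i (mulOp β i g) y = _
    rw [weightOp_pow_apply, mulOp_apply hβ', smul_apply, sub_apply, smul_apply,
      realMulOp_apply hbt, hβ, hq]
    simp only
    rw [← mul_assoc, ← mul_assoc, ← Complex.ofReal_mul, jbr_mul, add_neg_cancel, jbr_zero,
      Complex.ofReal_one, one_mul, hc]
    push_cast
    simp only [smul_eq_mul]
    ring
  have e2 : mulOp a i f
      = c' • realMulOp (fun x => jbr x (κ + 1)) (mulOp (fun i x => φ (x - i.2)) i f) := by
    ext y
    rw [mulOp_apply ha'.isTame, smul_apply, realMulOp_apply hwt, mulOp_apply hφr.isTame, ha, hr, hc']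
    simp only [smul_eq_mul, Complex.ofReal_mul]
    ring
  set g := realMulOp (fun x => jbr x (κ + 1)) (mulOp (fun i x => φ (x - i.2)) i f)
  change (weightOp ^ P) i (bracketOp i.1 (-1) ((weightOp ^ P * mulOp β) i (mulOp a i f))
    - (weightOp ^ P * mulOp β) i (bracketOp i.1 (-1) (mulOp a i f))) x = _
  rw [weightOp_pow_apply, e1, e1, e2, commOp_apply]
  congr 2
  simp only [map_smul, map_sub, smul_sub, smul_smul]
  rw [hcc, one_smul, one_smul]
  abel

lemma integrable_pairing (g u : 𝓢(Plane, ℂ)) : Integrable fun x => inner ℂ (g x) (u x) := by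
  refine ((u.memLp 2).integrable_mul ((g.memLp 2).star) :
    Integrable (fun x => u x * star (g x))).congr (Filter.Eventually.of_forall fun x => ?_)
  simp [RCLike.inner_apply]

lemma pairing_realMulOp {b : Plane → ℝ} (hb : (fun x => (b x : ℂ)).HasTemperateGrowth)
    (g u : 𝓢(Plane, ℂ)) :
    ∫ x, inner ℂ (realMulOp b g x) (u x) = ∫ x, inner ℂ (g x) (realMulOp b u x) := by
  congr 1; ext1 x
  rw [realMulOp_apply hb, realMulOp_apply hb]
  simp only [RCLike.inner_apply, map_mul, Complex.conj_ofReal]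
  ring

lemma pairing_bracketOp (h s : ℝ) (g u : 𝓢(Plane, ℂ)) :
    ∫ x, inner ℂ (bracketOp h s g x) (u x) = ∫ x, inner ℂ (g x) (bracketOp h s u x) := by
  rw [← SchwartzMap.integral_inner_fourier_fourier,
    ← SchwartzMap.integral_inner_fourier_fourier g]
  congr 1; ext1 ξ
  rw [fourier_bracketOp, fourier_bracketOp]
  simp only [RCLike.inner_apply, map_mul, Complex.conj_ofReal]
  ring

/-- The commutator of two symmetric operators is antisymmetric. -/
lemma pairing_commOp {b : Plane → ℝ} (hb : (fun x => (b x : ℂ)).HasTemperateGrowth) (h : ℝ)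
    (g u : 𝓢(Plane, ℂ)) :
    ∫ x, inner ℂ (commOp b h g x) (u x) = -∫ x, inner ℂ (g x) (commOp b h u x) := by
  simp only [commOp_apply, sub_apply, inner_sub_left, inner_sub_right]
  rw [integral_sub (integrable_pairing _ _) (integrable_pairing _ _),
    integral_sub (integrable_pairing _ _) (integrable_pairing _ _), pairing_bracketOp,
    pairing_realMulOp hb, pairing_realMulOp hb, pairing_bracketOp, neg_sub]

lemma enorm_pairing_le (h t : ℝ) (g u : 𝓢(Plane, ℂ)) :
    ‖∫ x, inner ℂ (g x) (u x)‖ₑ ≤ sobNorm h (-t) g * sobNorm h t u := by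
  rw [← SchwartzMap.integral_inner_fourier_fourier]
  refine (enorm_integral_le_lintegral_enorm _).trans ?_
  rw [← ENNReal.pow_le_pow_left_iff two_ne_zero, mul_pow, sobNorm, sobNorm, eLpNorm_two_sq,
    eLpNorm_two_sq]
  refine le_trans (le_of_eq ?_) (lintegral_mul_sq_le ?_ ?_)
  · congr 2; ext1 ξ
    rw [← enorm_mul, mul_mul_mul_comm, ← Complex.ofReal_mul, jbr_mul, neg_add_cancel, jbr_zero,
      Complex.ofReal_one, one_mul, RCLike.inner_apply, enorm_mul, enorm_mul, mul_comm,
      RCLike.enorm_conj]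
  all_goals
    exact (((Complex.measurable_ofReal.comp (measurable_jbr_smul _ _)).mul
      (SchwartzMap.continuous _).measurable).enorm).aemeasurable

/-- The commutator bound in weak form. -/
lemma exists_enorm_pairing_commOp_le {κ : ℝ} {b : Plane → ℝ} (hκ : 0 ≤ κ) (hb : ContDiff ℝ ∞ b)
    (hd : ∀ n : ℕ, ∃ C : ℝ, ∀ y : Plane, ‖iteratedFDeriv ℝ n b y‖ ≤ C * jbr y (-κ - n)) (s : ℝ) :
    ∃ C : ℝ, 0 ≤ C ∧ ∀ (h : Set.Ioo (0 : ℝ) 1) (g v : 𝓢(Plane, ℂ)),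
      ‖∫ x, inner ℂ (g x) (commOp b h (realMulOp (fun x => jbr x (κ + 1)) v) x)‖ₑ
        ≤ ENNReal.ofReal (C * h) * (sobNorm h (-(s + 2)) g * sobNorm h s v) := by
  have hbt := coefficient_temperate hκ hb hd
  have hwt : (fun x => (jbr x (κ + 1) : ℂ)).HasTemperateGrowth := temperate_ofReal (jbr_temperate _)
  obtain ⟨P, hP'⟩ := exists_nat_ge (κ + 5)
  have hP : κ + 5 ≤ 2 * P := hP'.trans (by linarith [(Nat.cast_nonneg P : (0 : ℝ) ≤ P)])
  let φ₀ : ContDiffBump (0 : Plane) := ⟨1, 2, one_pos, one_lt_two⟩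
  obtain ⟨φ, hφ⟩ : ∃ φ : Plane → ℂ, ∀ x, φ x = (φ₀ x : ℂ) := ⟨_, fun _ => rfl⟩
  have hφe : φ = fun x => (φ₀ x : ℂ) := funext hφ
  have hφs : ContDiff ℝ ∞ φ := hφe ▸ Complex.ofRealCLM.contDiff.comp φ₀.contDiff
  have hφc : HasCompactSupport φ := hφe ▸ φ₀.hasCompactSupport.comp_left Complex.ofReal_zero
  have hφi : Integrable fun y => φ y * φ y :=
    (hφs.continuous.mul hφs.continuous).integrable_of_hasCompactSupport hφc.mul_right
  obtain ⟨c, hc⟩ : ∃ c : ℂ, c = ∫ y, φ y * φ y := ⟨_, rfl⟩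
  have hc0 : c ≠ 0 := by
    have h1 : 0 < ∫ y, φ₀ y * φ₀ y :=
      Continuous.integral_pos_of_hasCompactSupport_nonneg_nonzero (x := 0)
        (φ₀.continuous.mul φ₀.continuous) φ₀.hasCompactSupport.mul_right
        (fun y => mul_self_nonneg _) (by
          simpa using (φ₀.pos_of_mem_ball (Metric.mem_ball_self φ₀.rOut_pos)).ne')
    rw [hc, hφe]
    simp_rw [← Complex.ofReal_mul]
    rw [integral_complex_ofReal]
    exact_mod_cast h1.ne'
  have hφt : IsTame fun i x => φ (x - i.2) := (isRapid_translate hφs hφc).isTame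
  obtain ⟨S, hS, hSe⟩ := exists_gaining_localized hκ hb hd hφs hφc hP
  obtain ⟨C₀, hC₀, hbd⟩ := sobNorm_le_of_mem_gaining hS s
  have hψt : IsTame fun i x => (jbr (x - i.2) (-(2 * P)) : ℂ) := by
    refine (uBound_jbr (fun i : Par => i.2) (-(2 * P))).mono zero_le_one fun i x => ?_
    rw [one_mul]
    exact jbr_mono _ (by linarith)
  obtain ⟨C₁, hC₁, hw₁⟩ := lintegral_sobNorm_window hφt (A := φ) (fun i x => rfl) s
  obtain ⟨C₂, hC₂, hw₂⟩ := lintegral_sobNorm_window hψt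
    (A := fun x => (jbr x (-(2 * P)) : ℂ)) (fun i x => rfl) (-(s + 2))
  refine ⟨‖c‖⁻¹ * (C₀ * √(C₂ * C₁)), by positivity, fun h g v => ?_⟩
  obtain ⟨X, hX⟩ : ∃ X, X = sobNorm h (-(s + 2)) g := ⟨_, rfl⟩
  obtain ⟨Y, hY⟩ : ∃ Y, Y = sobNorm h s v := ⟨_, rfl⟩
  obtain ⟨N₁, hN₁⟩ : ∃ N : Plane → ℝ≥0∞, ∀ k, N k = sobNorm h (-(s + 2))
    (mulOp (fun i x => (jbr (x - i.2) (-(2 * P)) : ℂ)) (h, k) g) := ⟨_, fun _ => rfl⟩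
  obtain ⟨N₂, hN₂⟩ : ∃ N : Plane → ℝ≥0∞, ∀ k, N k = sobNorm h s
    (mulOp (fun i x => φ (x - i.2)) (h, k) v) := ⟨_, fun _ => rfl⟩
  have hm₁ := (hw₂ h g).1
  have hm₂ := (hw₁ h v).1
  have hl₁ := (hw₂ h g).2
  have hl₂ := (hw₁ h v).2
  simp_rw [← hN₁, ← hX] at hm₁ hl₁
  simp_rw [← hN₂, ← hY] at hm₂ hl₂
  rw [← hX, ← hY]
  obtain ⟨F, hF⟩ : ∃ F : Plane → ℂ, ∀ x, F x = inner ℂ (commOp b h g x)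
    (realMulOp (fun x => jbr x (κ + 1)) v x) := ⟨_, fun _ => rfl⟩
  have hFi : Integrable F := by
    rw [show F = _ from funext hF]; exact integrable_pairing _ _
  have hpair : ∫ x, F x
      = -∫ x, inner ℂ (g x) (commOp b h (realMulOp (fun x => jbr x (κ + 1)) v) x) := by
    simp_rw [hF]; exact pairing_commOp hbt _ _ _
  have hconv : ∫ k, ∫ x, F x * (φ (x - k) * φ (x - k)) = (∫ x, F x) * c := by
    have h1 := integral_convolution (ContinuousLinearMap.mul ℝ ℂ) hFi hφi
    rw [← hc, ContinuousLinearMap.mul_apply'] at h1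
    rw [← h1]
    congr 1; ext1 k
    rw [convolution]
    congr 1; ext1 x
    rw [ContinuousLinearMap.mul_apply', hφ, hφ, ← neg_sub, φ₀.neg]
  have hloc : ∀ k, ‖∫ x, F x * (φ (x - k) * φ (x - k))‖ₑ
      ≤ ENNReal.ofReal (C₀ * h) * (N₁ k * N₂ k) := by
    intro k
    obtain ⟨f, hf⟩ : ∃ f, f = mulOp (fun i x => φ (x - i.2)) (h, k) v := ⟨_, rfl⟩
    have e1 : ∫ x, F x * (φ (x - k) * φ (x - k)) = ∫ x, inner ℂ (commOp b h g x)
        (realMulOp (fun x => jbr x (κ + 1)) (mulOp (fun i x => φ (x - i.2)) (h, k) f) x) := by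
      congr 1; ext1 x
      rw [hF, realMulOp_apply hwt, realMulOp_apply hwt, mulOp_apply hφt, hf, mulOp_apply hφt]
      simp only [RCLike.inner_apply]
      ring
    have e2 : ∫ x, inner ℂ (g x) (commOp b h (realMulOp (fun x => jbr x (κ + 1))
          (mulOp (fun i x => φ (x - i.2)) (h, k) f)) x)
        = ∫ x, inner ℂ (mulOp (fun i x => (jbr (x - i.2) (-(2 * P)) : ℂ)) (h, k) g x)
          (S (h, k) f x) := by
      congr 1; ext1 x
      rw [hSe, mulOp_apply hψt]
      have e3 : (jbr (x - k) (2 * P) : ℂ) * (jbr (x - k) (-(2 * P)) : ℂ) = 1 := by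
        rw [← Complex.ofReal_mul, jbr_mul, add_neg_cancel, jbr_zero, Complex.ofReal_one]
      simp only [RCLike.inner_apply, map_mul, Complex.conj_ofReal]
      linear_combination (-(commOp b h (realMulOp (fun x => jbr x (κ + 1))
          (mulOp (fun i x => φ (x - i.2)) (h, k) f)) x) * (starRingEnd ℂ) (g x)) * e3
    rw [e1, pairing_commOp hbt, enorm_neg, e2]
    refine (enorm_pairing_le h (s + 2) _ _).trans ?_
    rw [← hN₁]
    refine (mul_le_mul_right (hbd (h, k) f) _).trans (le_of_eq ?_)
    rw [hf, ← hN₂]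
    ring
  have hCS : ∫⁻ k, N₁ k * N₂ k ≤ ENNReal.ofReal (√(C₂ * C₁)) * (X * Y) := by
    rw [← ENNReal.pow_le_pow_left_iff two_ne_zero]
    refine (lintegral_mul_sq_le hm₁.aemeasurable hm₂.aemeasurable).trans
      ((mul_le_mul' hl₁ hl₂).trans (le_of_eq ?_))
    rw [mul_pow, ← ENNReal.ofReal_pow (Real.sqrt_nonneg _), Real.sq_sqrt (by positivity),
      ENNReal.ofReal_mul hC₂]
    ring
  have hfin : ‖∫ x, F x‖ₑ * ‖c‖ₑ ≤ ENNReal.ofReal (C₀ * h) *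
      (ENNReal.ofReal (√(C₂ * C₁)) * (X * Y)) := by
    rw [← enorm_mul, ← hconv]
    refine (enorm_integral_le_lintegral_enorm _).trans ((lintegral_mono hloc).trans ?_)
    rw [lintegral_const_mul _ (hm₁.fun_mul hm₂)]
    exact mul_le_mul_right hCS _
  have hh : 0 < (h : ℝ) := h.2.1
  have hcc : ‖c‖ₑ * ENNReal.ofReal ‖c‖⁻¹ = 1 := by
    rw [← ofReal_norm, ← ENNReal.ofReal_mul (norm_nonneg _), mul_inv_cancel₀ (norm_ne_zero_iff.2 hc0),
      ENNReal.ofReal_one]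
  rw [hpair, enorm_neg] at hfin
  calc _ = _ * (‖c‖ₑ * ENNReal.ofReal ‖c‖⁻¹) := by rw [hcc, mul_one]
    _ ≤ (ENNReal.ofReal (C₀ * h) * (ENNReal.ofReal (√(C₂ * C₁)) * (X * Y))) *
        ENNReal.ofReal ‖c‖⁻¹ := by
      rw [← mul_assoc]; exact mul_le_mul_left hfin _
    _ = ENNReal.ofReal (C₀ * h) * ENNReal.ofReal (√(C₂ * C₁)) * ENNReal.ofReal ‖c‖⁻¹ * (X * Y) := by
      ring
    _ = _ := by
      rw [← ENNReal.ofReal_mul (by positivity), ← ENNReal.ofReal_mul (by positivity)]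
      congr 2; ring

lemma sobNorm_bracketOp (h s t : ℝ) (f : 𝓢(Plane, ℂ)) :
    sobNorm h s (bracketOp h t f) = sobNorm h (s + t) f := by
  rw [sobNorm, sobNorm]
  congr 1; ext1 ξ
  rw [fourier_bracketOp, ← mul_assoc, ← Complex.ofReal_mul, jbr_mul]

lemma sobNorm_eq_eLpNorm_fourier (h s : ℝ) (f : 𝓢(Plane, ℂ)) :
    sobNorm h s f = eLpNorm (𝓕 (bracketOp h s f) : 𝓢(Plane, ℂ)) 2 := by
  rw [sobNorm]
  congr 1; ext1 ξ
  rw [fourier_bracketOp]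

lemma sobNorm_lt_top (h s : ℝ) (f : 𝓢(Plane, ℂ)) : sobNorm h s f < ⊤ := by
  rw [sobNorm_eq_eLpNorm_fourier]
  generalize (𝓕 (bracketOp h s f) : 𝓢(Plane, ℂ)) = g
  exact (g.memLp 2 volume).2

lemma sobNorm_eq_eLpNorm (h s : ℝ) (f : 𝓢(Plane, ℂ)) :
    sobNorm h s f = eLpNorm (bracketOp h s f) 2 := by
  rw [sobNorm_eq_eLpNorm_fourier, SchwartzMap.fourier_coe]
  exact eLpNorm_fourier_eq (bracketOp h s f).integrable ((bracketOp h s f).memLp 2)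

lemma enorm_pairing_bracketOp (h t : ℝ) (u : 𝓢(Plane, ℂ)) :
    ‖∫ x, inner ℂ (bracketOp h (2 * t) u x) (u x)‖ₑ = sobNorm h t u ^ 2 := by
  have e : bracketOp h (2 * t) u = bracketOp h t (bracketOp h t u) := by
    apply (FourierTransform.fourierEquiv ℂ 𝓢(Plane, ℂ)).injective
    ext ξ
    change 𝓕 (bracketOp h (2 * t) u) ξ = 𝓕 (bracketOp h t (bracketOp h t u)) ξ
    rw [fourier_bracketOp, fourier_bracketOp, fourier_bracketOp, ← mul_assoc, ← Complex.ofReal_mul,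
      jbr_mul, two_mul]
  rw [e, pairing_bracketOp, sobNorm_eq_eLpNorm, eLpNorm_two_sq]
  have h1 : ∀ x, inner ℂ (bracketOp h t u x) (bracketOp h t u x)
      = ((‖bracketOp h t u x‖ ^ 2 : ℝ) : ℂ) := fun x => by
    rw [inner_self_eq_norm_sq_to_K]; norm_cast
  simp_rw [h1]
  have h2 : Integrable fun x => ‖bracketOp h t u x‖ ^ 2 :=
    ((bracketOp h t u).memLp 2).integrable_norm_pow two_ne_zero
  rw [integral_complex_ofReal, ← ofReal_norm, Complex.norm_real,
    Real.norm_of_nonneg (integral_nonneg fun x => sq_nonneg _),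
    ofReal_integral_eq_lintegral_ofReal h2
      (Filter.Eventually.of_forall fun x => sq_nonneg _)]
  congr 1; ext1 x
  rw [ENNReal.ofReal_pow (norm_nonneg _), ofReal_norm]

/-- The commutator bound on Schwartz space. -/
lemma exists_sobNorm_commOp_le {κ : ℝ} {b : Plane → ℝ} (hκ : 0 ≤ κ) (hb : ContDiff ℝ ∞ b)
    (hd : ∀ n : ℕ, ∃ C : ℝ, ∀ y : Plane, ‖iteratedFDeriv ℝ n b y‖ ≤ C * jbr y (-κ - n)) (s : ℝ) :
    ∃ C : ℝ, 0 ≤ C ∧ ∀ (h : Set.Ioo (0 : ℝ) 1) (v : 𝓢(Plane, ℂ)),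
      sobNorm h (s + 2) (commOp b h (realMulOp (fun x => jbr x (κ + 1)) v))
        ≤ ENNReal.ofReal (C * h) * sobNorm h s v := by
  obtain ⟨C, hC, hbd⟩ := exists_enorm_pairing_commOp_le hκ hb hd s
  refine ⟨C, hC, fun h v => ?_⟩
  obtain ⟨u, hu⟩ : ∃ u, u = commOp b h (realMulOp (fun x => jbr x (κ + 1)) v) := ⟨_, rfl⟩
  have h1 := hbd h (bracketOp h (2 * (s + 2)) u) v
  rw [← hu, enorm_pairing_bracketOp, sobNorm_bracketOp,
    show -(s + 2) + 2 * (s + 2) = s + 2 by ring] at h1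
  rw [← hu]
  by_cases h0 : sobNorm h (s + 2) u = 0
  · rw [h0]; exact zero_le
  refine (ENNReal.mul_le_mul_iff_right h0 (sobNorm_lt_top _ _ _).ne).1 ?_
  rw [← sq]
  exact h1.trans (le_of_eq (by ring))

lemma sclBracket_coe (h s : ℝ) (f : 𝓢(Plane, ℂ)) : sclBracket h s f = bracketOp h s f := by
  rw [sclBracket, bracketOp, SchwartzMap.fourierMultiplierCLM_apply, SchwartzMap.fourierInv_coe]
  congr 1; ext1 ξ
  rw [SchwartzMap.smulLeftCLM_apply_apply (jbr_smul_temperate h s), SchwartzMap.fourier_coe, jbr,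
    norm_smul, mul_pow, Real.norm_eq_abs, sq_abs, smul_eq_mul, Complex.real_smul]

lemma sclNorm_coe (h s : ℝ) (f : 𝓢(Plane, ℂ)) : sclNorm h s f = sobNorm h s f := by
  rw [sclNorm, sclBracket_coe, sobNorm_eq_eLpNorm]

lemma sclCommutator_coe {b : Plane → ℝ} (hb : (fun x => (b x : ℂ)).HasTemperateGrowth) (h : ℝ)
    (f : 𝓢(Plane, ℂ)) : sclCommutator h b f = commOp b h f := by
  ext1 y
  rw [sclCommutator, ← funext (realMulOp_apply hb f), sclBracket_coe, sclBracket_coe, commOp_apply,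
    sub_apply, realMulOp_apply hb]

end Scl

/-- **Lemma 3.5.**  Let `κ ≥ 0` and `b ∈ C^∞(ℝ²)` with
`|∂_y^β b(y)| ≤ C_β ⟨y⟩^{-κ-|β|}` for all `β`.  Then for every `s ∈ ℝ` there is
a constant `C` with `‖[⟨hD⟩⁻¹, b]u‖_{H^{s+2}_{scl}} ≤ C h ‖⟨y⟩^{-κ-1}u‖_{H^s_{scl}}`
for all `u ∈ C_0^∞(ℝ²)` and all small `h > 0`. -/
theorem semiclassical_commutator_decay
    (κ : ℝ) (hκ : 0 ≤ κ) (b : Plane → ℝ) (hb : ContDiff ℝ (⊤ : ℕ∞) b)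
    (hbdecay : ∀ n : ℕ, ∃ Cn : ℝ, ∀ y : Plane,
      ‖iteratedFDeriv ℝ n b y‖ ≤ Cn * jbr y (-κ - n)) :
    ∀ s : ℝ, ∃ C : ℝ, 0 < C ∧ ∃ h₀ : ℝ, 0 < h₀ ∧
      ∀ h : ℝ, 0 < h → h < h₀ →
        ∀ u : Plane → ℂ, ContDiff ℝ (⊤ : ℕ∞) u → HasCompactSupport u →
          sclNorm h (s + 2) (sclCommutator h b u)
            ≤ ENNReal.ofReal (C * h) *
                sclNorm h s (fun y => (jbr y (-κ - 1) : ℝ) • u y) := by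
  intro s
  obtain ⟨C, hC, hbd⟩ := Scl.exists_sobNorm_commOp_le hκ hb hbdecay s
  refine ⟨C + 1, by positivity, 1, one_pos, fun h hh hh1 u hu huc => ?_⟩
  have hv : ContDiff ℝ (⊤ : ℕ∞) fun y => (jbr y (-κ - 1) : ℝ) • u y :=
    (Scl.jbr_contDiff _).smul hu
  let f := huc.toSchwartzMap hu
  let v := (huc.smul_left (f := fun y => jbr y (-κ - 1))).toSchwartzMap hv
  have hw : (fun x => (jbr x (κ + 1) : ℂ)).HasTemperateGrowth :=
    Scl.temperate_ofReal (Scl.jbr_temperate _)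
  have hfv : f = Scl.realMulOp (fun x => jbr x (κ + 1)) v := by
    ext y
    rw [Scl.realMulOp_apply hw]
    change u y = (jbr y (κ + 1) : ℂ) * ((jbr y (-κ - 1) : ℝ) • u y)
    rw [Complex.real_smul, ← mul_assoc, ← Complex.ofReal_mul, Scl.jbr_mul,
      show κ + 1 + (-κ - 1) = 0 by ring, Scl.jbr_zero, Complex.ofReal_one, one_mul]
  change sclNorm h (s + 2) (sclCommutator h b f) ≤ _ * sclNorm h s v
  rw [Scl.sclCommutator_coe (Scl.coefficient_temperate hκ hb hbdecay), Scl.sclNorm_coe,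
    Scl.sclNorm_coe, hfv]
  refine (hbd ⟨h, hh, hh1⟩ v).trans (mul_le_mul_left (ENNReal.ofReal_le_ofReal ?_) _)
  exact mul_le_mul_of_nonneg_right (by linarith) hh.le
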